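/- arXiv:2310.03974 — 4 statements merged into one kernel-verified Lean document; each statement's English description precedes it below -/
import Mathlib

section
/- There exist an absolute constant C > 0 and a function ε : ℕ → [0,1] with ε(r) → 0 as r → ∞ such that the following holds. Let H be an r-bounded κ-spread multi-hypergraph with r ≥ 2, let X = V(H), let k ≥ r be an integer, and let X' = X × [k]. If C log r / κ ≤ p ≤ 1, then with probability at least 1 − ε(r), the random subset X'_{p/k} contains a set S' = {(x₁,i₁),(x₂,i₂),…,(x_t,i_t)} such that {x₁,…,x_t} is an edge of H and i₁,…,i_t are pairwise distinct elements of [k]. -/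
open Finset
open scoped Classical

/-- A multi-hypergraph `H` (a multiset of edges) is `κ`-spread: for every `S ⊆ X`,
the number of edges of `H` containing `S` (with multiplicity) is at most `κ^{-|S|}|H|`. -/
def Spread {α : Type*} [DecidableEq α] (κ : ℝ) (H : Multiset (Finset α)) : Prop :=
  ∀ S : Finset α, ((H.filter fun E => S ⊆ E).card : ℝ) ≤ κ⁻¹ ^ S.card * (H.card : ℝ)

/-- The probability that, when each element of `X` is colored independently and uniformly
at random from `[k]` and each element of `X` is kept independently with probability `p`,
the random subset `X_p` contains a rainbow edge of `H` (an edge all of whose elements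
receive pairwise distinct colors). -/
noncomputable def rainbowProb {α : Type*} [Fintype α] [DecidableEq α] (k : ℕ) (p : ℝ)
    (H : Multiset (Finset α)) : ℝ :=
  ∑ c : α → Fin k, ∑ W : Finset α,
    ((k : ℝ) ^ Fintype.card α)⁻¹ * p ^ W.card * (1 - p) ^ (Fintype.card α - W.card) *
      (if ∃ E ∈ H, E ⊆ W ∧ Set.InjOn c ↑E then 1 else 0)

/-- The probability that a random subset of `X' = X × [k]`, where each element is kept
independently with probability `q`, contains a set `{(x₁,i₁),…,(x_t,i_t)}` with
`{x₁,…,x_t}` an edge of `H` (the `xⱼ` distinct) and `i₁,…,i_t` pairwise distinct. -/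
noncomputable def transProb {α : Type*} [Fintype α] [DecidableEq α] (k : ℕ) (q : ℝ)
    (H : Multiset (Finset α)) : ℝ :=
  ∑ W : Finset (α × Fin k),
    q ^ W.card * (1 - q) ^ (Fintype.card (α × Fin k) - W.card) *
      (if ∃ S ⊆ W, S.image Prod.fst ∈ H ∧ (S.image Prod.fst).card = S.card ∧
          (S.image Prod.snd).card = S.card then 1 else 0)

/-- The expectation of `f` at a random subset of `S` keeping each element with probability `p`. -/
noncomputable def subsetExp {β : Type*} (p : ℝ) (S : Finset β) (f : Finset β → ℝ) : ℝ :=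
  ∑ W ∈ S.powerset, p ^ W.card * (1 - p) ^ (S.card - W.card) * f W

section subsetExp

variable {β : Type*}

theorem subsetExp_add (p : ℝ) (S : Finset β) (f g : Finset β → ℝ) :
    subsetExp p S (fun W => f W + g W) = subsetExp p S f + subsetExp p S g := by
  simp only [subsetExp, mul_add, Finset.sum_add_distrib]

theorem subsetExp_const_mul (p a : ℝ) (S : Finset β) (f : Finset β → ℝ) :
    subsetExp p S (fun W => a * f W) = a * subsetExp p S f := by
  simp only [subsetExp, Finset.mul_sum]
  exact Finset.sum_congr rfl fun W _ => by ring

theorem subsetExp_mono {p : ℝ} (h0 : 0 ≤ p) (h1 : p ≤ 1) (S : Finset β) {f g : Finset β → ℝ}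
    (h : ∀ W, f W ≤ g W) : subsetExp p S f ≤ subsetExp p S g := by
  have : 0 ≤ 1 - p := by linarith
  exact Finset.sum_le_sum fun W _ => mul_le_mul_of_nonneg_left (h W) (by positivity)

theorem subsetExp_insert [DecidableEq β] (p : ℝ) {x : β} {S : Finset β} (hx : x ∉ S)
    (f : Finset β → ℝ) :
    subsetExp p (insert x S) f =
      p * subsetExp p S (fun W => f (insert x W)) + (1 - p) * subsetExp p S f := by
  simp only [subsetExp]
  rw [Finset.sum_powerset_insert hx, Finset.mul_sum, Finset.mul_sum, add_comm]
  congr 1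
  · refine Finset.sum_congr rfl fun W hW => ?_
    have hWS := Finset.mem_powerset.1 hW
    rw [Finset.card_insert_of_notMem hx, Finset.card_insert_of_notMem fun h => hx (hWS h),
      Nat.add_sub_add_right]
    ring
  · refine Finset.sum_congr rfl fun W hW => ?_
    have hc := Finset.card_le_card (Finset.mem_powerset.1 hW)
    rw [Finset.card_insert_of_notMem hx, Nat.sub_add_comm hc]
    ring

theorem subsetExp_const [DecidableEq β] (p a : ℝ) (S : Finset β) :
    subsetExp p S (fun _ => a) = a := by
  induction S using Finset.induction_on with
  | empty => simp [subsetExp]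
  | insert x S hx ih => rw [subsetExp_insert p hx, ih]; ring

/-- The union of independent random subsets with densities `p` and `p'` is a random subset
of density `p + p' - p p'`. -/
theorem subsetExp_union [DecidableEq β] (p p' : ℝ) (S : Finset β) (f : Finset β → ℝ) :
    subsetExp p S (fun A => subsetExp p' S fun B => f (A ∪ B)) =
      subsetExp (p + p' - p * p') S f := by
  induction S using Finset.induction_on generalizing f with
  | empty => simp [subsetExp]
  | insert x S hx ih =>
    simp only [subsetExp_insert _ hx, subsetExp_add, subsetExp_const_mul, Finset.insert_union,
      Finset.union_insert, Finset.insert_idem]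
    rw [ih f, ih fun W => f (insert x W)]
    ring

end subsetExp

/-- The set `W` contains an edge of `H`. -/
def HasEdge {β : Type*} (H : Finset (Finset β)) (W : Finset β) : Prop := ∃ S ∈ H, S ⊆ W

/-- The probability that a random subset of density `p` contains an edge of `H`. -/
noncomputable def hitProb {β : Type*} [Fintype β] (p : ℝ) (H : Finset (Finset β)) : ℝ :=
  subsetExp p univ fun W => if HasEdge H W then 1 else 0

/-- The family `G` covers `H` if every edge of `H` contains a member of `G`. -/
def IsCover {β : Type*} (G H : Finset (Finset β)) : Prop := ∀ S ∈ H, ∃ T ∈ G, T ⊆ S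

theorem isCover_singleton_empty {β : Type*} (H : Finset (Finset β)) : IsCover {∅} H :=
  fun _ _ => ⟨∅, by simp⟩

/-- The least total weight of a cover of `H`, where a set `T` has weight `q ^ |T|`. -/
noncomputable def coverCost {β : Type*} [Fintype β] (q : ℝ) (H : Finset (Finset β)) : ℝ :=
  (univ.filter fun G => IsCover G H).inf'
    ⟨{∅}, Finset.mem_filter.2 ⟨Finset.mem_univ _, isCover_singleton_empty H⟩⟩
    fun G => ∑ T ∈ G, q ^ T.card

theorem coverCost_le {β : Type*} [Fintype β] {q : ℝ} {G H : Finset (Finset β)}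
    (h : IsCover G H) :
    coverCost q H ≤ ∑ T ∈ G, q ^ T.card := by
  have hG : G ∈ univ.filter fun G => IsCover G H := Finset.mem_filter.2 ⟨Finset.mem_univ _, h⟩
  unfold coverCost
  exact Finset.inf'_le (fun G : Finset (Finset β) => ∑ T ∈ G, q ^ T.card) hG

theorem exists_isCover_coverCost {β : Type*} [Fintype β] (q : ℝ)
    (H : Finset (Finset β)) :
    ∃ G, IsCover G H ∧ coverCost q H = ∑ T ∈ G, q ^ T.card := by
  obtain ⟨G, hG, h⟩ := Finset.exists_mem_eq_inf' (s := univ.filter fun G => IsCover G H)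
    ⟨{∅}, Finset.mem_filter.2 ⟨Finset.mem_univ _, isCover_singleton_empty H⟩⟩
    fun G => ∑ T ∈ G, q ^ T.card
  exact ⟨G, (Finset.mem_filter.1 hG).2, h⟩

/-- No set `S \ W` with `S ∈ H` is a proper subset of `T`. -/
def IsMinimalFragment {β : Type*} [DecidableEq β] (H : Finset (Finset β)) (W T : Finset β) :
    Prop := ∀ S ∈ H, S \ W ⊆ T → S \ W = T

/-- The inclusion-minimal sets of the form `S \ W` with `S ∈ H`. -/
noncomputable def fragments {β : Type*} [DecidableEq β] (H : Finset (Finset β)) (W : Finset β) :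
    Finset (Finset β) :=
  (H.image (· \ W)).filter (IsMinimalFragment H W)

section cover

variable {β : Type*} [Fintype β] [DecidableEq β]

theorem exists_fragment_subset {H : Finset (Finset β)} {S : Finset β} (hS : S ∈ H)
    (W : Finset β) : ∃ T ∈ fragments H W, T ⊆ S \ W := by
  obtain ⟨A, hA, hmin⟩ := Finset.exists_min_image (H.filter fun A => A \ W ⊆ S \ W)
    (fun A => (A \ W).card) ⟨S, by simp [hS]⟩
  rw [Finset.mem_filter] at hA
  refine ⟨A \ W, Finset.mem_filter.2 ⟨Finset.mem_image_of_mem _ hA.1, fun B hB hBA => ?_⟩, hA.2⟩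
  exact Finset.eq_of_subset_of_card_le hBA
    (hmin B (Finset.mem_filter.2 ⟨hB, hBA.trans hA.2⟩))

theorem coverCost_le_fragments {q : ℝ} (hq : 0 ≤ q) (H : Finset (Finset β)) (m : ℕ)
    (W : Finset β) :
    coverCost q H ≤ coverCost q ((fragments H W).filter fun T => T.card ≤ m) +
      ∑ T ∈ (fragments H W).filter (fun T => m < T.card), q ^ T.card := by
  obtain ⟨G, hG, h⟩ := exists_isCover_coverCost q ((fragments H W).filter fun T => T.card ≤ m)
  have hcov : IsCover (G ∪ (fragments H W).filter fun T => m < T.card) H := by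
    intro S hS
    obtain ⟨T, hT, hTS⟩ := exists_fragment_subset hS W
    have hTS' := hTS.trans Finset.sdiff_subset
    rcases le_or_gt T.card m with hm | hm
    · obtain ⟨A, hA, hAT⟩ := hG T (Finset.mem_filter.2 ⟨hT, hm⟩)
      exact ⟨A, Finset.mem_union_left _ hA, hAT.trans hTS'⟩
    · exact ⟨T, Finset.mem_union_right _ (Finset.mem_filter.2 ⟨hT, hm⟩), hTS'⟩
  rw [h]
  refine (coverCost_le hcov).trans ?_
  rw [← Finset.sum_union_inter]
  exact le_add_of_nonneg_right (Finset.sum_nonneg fun T _ => by positivity)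

/-- The expected cost of the large fragments: a large fragment `T` for `W` is a subset of any
edge contained in `W ∪ T`. -/
theorem subsetExp_fragments_le {p q e : ℝ} (hp : 0 < p) (hp1 : p ≤ 1) (hq : 0 ≤ q) (he : 0 ≤ e)
    (H : Finset (Finset β)) (m : ℕ)
    (hH : ∀ S ∈ H, ∑ T ∈ S.powerset with m < T.card, (q / p) ^ T.card ≤ e) :
    subsetExp p univ (fun W =>
      ∑ T ∈ (fragments H W).filter (fun T => m < T.card), q ^ T.card) ≤ e := by
  have hp1' : 0 ≤ 1 - p := by linarith
  set μ : Finset β → ℝ := fun W => p ^ W.card * (1 - p) ^ ((univ : Finset β).card - W.card)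
    with hμ
  have hμ0 : ∀ W, 0 ≤ μ W := fun W => by positivity
  set V : Finset β → Finset (Finset β) := fun Z =>
    if h : HasEdge H Z then h.choose.powerset.filter fun T => m < T.card else ∅ with hV
  have hVsum : ∀ Z, ∑ T ∈ V Z, (q / p) ^ T.card ≤ e := by
    intro Z
    simp only [hV]
    split_ifs with h
    · exact hH _ h.choose_spec.1
    · simpa using he
  set U : Finset β → Finset (Finset β) := fun W =>
    (fragments H W).filter fun T => m < T.card with hU
  have hdisj : ∀ W, ∀ T ∈ U W, Disjoint W T := by
    intro W T hT
    obtain ⟨S, -, rfl⟩ := Finset.mem_image.1 (Finset.mem_filter.1 (Finset.mem_filter.1 hT).1).1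
    exact Finset.disjoint_sdiff
  have hUV : ∀ W, ∀ T ∈ U W, T ∈ V (W ∪ T) := by
    intro W T hT
    obtain ⟨hT1, hT2⟩ := Finset.mem_filter.1 hT
    obtain ⟨hT3, hmin⟩ := Finset.mem_filter.1 hT1
    obtain ⟨S, hS, hST⟩ := Finset.mem_image.1 hT3
    have h : HasEdge H (W ∪ T) := ⟨S, hS, by
      rw [← hST]; intro x hx; by_cases hxW : x ∈ W <;> simp [hx, hxW]⟩
    simp only [hV, dif_pos h]
    refine Finset.mem_filter.2 ⟨Finset.mem_powerset.2 ?_, hT2⟩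
    have := hmin _ h.choose_spec.1 (sdiff_le_iff.2 h.choose_spec.2)
    exact this.symm.subset.trans Finset.sdiff_subset
  have hweight : ∀ W, ∀ T ∈ U W, μ W * q ^ T.card ≤ μ (W ∪ T) * (q / p) ^ T.card := by
    intro W T hT
    have hc := Finset.card_union_of_disjoint (hdisj W T hT)
    have hle := Finset.card_le_univ (W ∪ T)
    rw [hc] at hle
    have hsub : (univ : Finset β).card - W.card =
        ((univ : Finset β).card - (W.card + T.card)) + T.card := by
      rw [Finset.card_univ]; omega
    have h1 : (1 - p) ^ T.card ≤ 1 := pow_le_one₀ hp1' (by linarith)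
    have h2 : q ^ T.card = p ^ T.card * (q / p) ^ T.card := by
      rw [← mul_pow, mul_div_cancel₀ _ hp.ne']
    simp only [hμ]
    rw [hc, hsub, pow_add, h2, pow_add]
    have h3 : 0 ≤ p ^ W.card * p ^ T.card *
        (1 - p) ^ ((univ : Finset β).card - (W.card + T.card)) * (q / p) ^ T.card := by
      positivity
    calc _ = p ^ W.card * p ^ T.card *
        (1 - p) ^ ((univ : Finset β).card - (W.card + T.card)) * (q / p) ^ T.card *
          (1 - p) ^ T.card := by ring
      _ ≤ _ := mul_le_of_le_one_right h3 h1
  have hinj : Set.InjOn (fun x : Finset β × Finset β => (x.1 ∪ x.2, x.2))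
      {x | Disjoint x.1 x.2} := by
    rintro ⟨W, T⟩ h ⟨W', T'⟩ h' heq
    simp only [Prod.mk.injEq] at heq
    obtain ⟨h1, rfl⟩ := heq
    have : W = W' := by
      change Disjoint W T at h
      change Disjoint W' T at h'
      rw [← Finset.union_sdiff_cancel_right h, h1, Finset.union_sdiff_cancel_right h']
    rw [this]
  calc subsetExp p univ (fun W => ∑ T ∈ U W, q ^ T.card)
      = ∑ x ∈ univ.filter (fun x : Finset β × Finset β => x.2 ∈ U x.1),
          μ x.1 * q ^ x.2.card := by
        simp only [subsetExp, Finset.powerset_univ, Finset.mul_sum]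
        rw [Finset.sum_filter, Fintype.sum_prod_type]
        refine Finset.sum_congr rfl fun W _ => ?_
        rw [← Finset.sum_filter]
        simp [hμ]
    _ ≤ ∑ x ∈ univ.filter (fun x : Finset β × Finset β => x.2 ∈ U x.1),
          μ (x.1 ∪ x.2) * (q / p) ^ x.2.card :=
        Finset.sum_le_sum fun x hx => hweight _ _ (Finset.mem_filter.1 hx).2
    _ = ∑ y ∈ (univ.filter fun x : Finset β × Finset β => x.2 ∈ U x.1).image
          (fun x : Finset β × Finset β => (x.1 ∪ x.2, x.2)), μ y.1 * (q / p) ^ y.2.card := by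
        rw [Finset.sum_image]
        exact hinj.mono fun x hx => hdisj _ _ (Finset.mem_filter.1 hx).2
    _ ≤ ∑ y ∈ univ.filter (fun y : Finset β × Finset β => y.2 ∈ V y.1),
          μ y.1 * (q / p) ^ y.2.card := by
        refine Finset.sum_le_sum_of_subset_of_nonneg ?_ fun y _ _ => ?_
        · intro y hy
          obtain ⟨x, hx, rfl⟩ := Finset.mem_image.1 hy
          exact Finset.mem_filter.2 ⟨Finset.mem_univ _, hUV _ _ (Finset.mem_filter.1 hx).2⟩
        · have := hμ0 y.1
          positivity
    _ = ∑ Z, μ Z * ∑ T ∈ V Z, (q / p) ^ T.card := by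
        rw [Finset.sum_filter, Fintype.sum_prod_type]
        refine Finset.sum_congr rfl fun Z _ => ?_
        rw [← Finset.sum_filter, Finset.mul_sum]
        simp
    _ ≤ ∑ Z, μ Z * e :=
        Finset.sum_le_sum fun Z _ => mul_le_mul_of_nonneg_left (hVsum Z) (hμ0 Z)
    _ = e := by
        have := subsetExp_const p e (univ : Finset β)
        simpa only [subsetExp, Finset.powerset_univ] using this

theorem hitProb_mono {p p' : ℝ} (h0 : 0 ≤ p) (h : p ≤ p') (h1 : p' ≤ 1)
    (H : Finset (Finset β)) : hitProb p H ≤ hitProb p' H := by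
  rcases h.eq_or_lt with rfl | hlt
  · exact le_rfl
  have hp : 0 < 1 - p := by linarith
  set s := (p' - p) / (1 - p) with hs
  have hs0 : 0 ≤ s := div_nonneg (by linarith) hp.le
  have hs1 : s ≤ 1 := (div_le_one hp).2 (by linarith)
  have hunion : p + s - p * s = p' := by
    have : s * (1 - p) = p' - p := div_mul_cancel₀ _ hp.ne'
    linarith
  unfold hitProb
  rw [← hunion, ← subsetExp_union]
  refine subsetExp_mono h0 (by linarith) _ fun A => ?_
  rw [← subsetExp_const s (if HasEdge H A then (1 : ℝ) else 0) (univ : Finset β)]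
  refine subsetExp_mono hs0 hs1 _ fun B => ?_
  split_ifs with hA hB hB
  · exact le_rfl
  · obtain ⟨S, hS, hSA⟩ := hA
    exact absurd ⟨S, hS, hSA.trans Finset.subset_union_left⟩ hB
  · exact zero_le_one
  · exact le_rfl

/-- One round of exposure: a bound for hypergraphs with edges of size at most `m` yields one for
hypergraphs whose large fragments are cheap. -/
theorem coverCost_sub_le_hitProb_of_round {p p' q e e' : ℝ} (hp : 0 < p) (hp1 : p ≤ 1)
    (hq : 0 ≤ q) (he : 0 ≤ e) (h0 : 0 ≤ p') (hpp : p + p' ≤ 1) (m : ℕ)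
    (hm : ∀ H : Finset (Finset β), (∀ S ∈ H, S.card ≤ m) → coverCost q H - e' ≤ hitProb p' H)
    (H : Finset (Finset β))
    (hH : ∀ S ∈ H, ∑ T ∈ S.powerset with m < T.card, (q / p) ^ T.card ≤ e) :
    coverCost q H - (e + e') ≤ hitProb (p + p') H := by
  have h1 : p' ≤ 1 := by linarith
  have hmono : hitProb (p + p' - p * p') H ≤ hitProb (p + p') H :=
    hitProb_mono (by nlinarith) (by nlinarith) hpp H
  refine le_trans ?_ hmono
  set f : Finset β → Finset (Finset β) :=
    fun W => (fragments H W).filter fun T => T.card ≤ m with hf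
  set g : Finset β → ℝ :=
    fun W => ∑ T ∈ (fragments H W).filter (fun T => m < T.card), q ^ T.card with hg
  have hexp : subsetExp p univ g ≤ e := subsetExp_fragments_le hp hp1 hq he H m hH
  have hround : ∀ W, coverCost q H + -e' ≤
      (subsetExp p' univ fun B => if HasEdge H (W ∪ B) then (1 : ℝ) else 0) + g W := by
    intro W
    have hcost := coverCost_le_fragments hq H m W
    have hsmall := hm (f W) fun T hT => (Finset.mem_filter.1 hT).2
    have hhit : hitProb p' (f W) ≤
        subsetExp p' univ fun B => if HasEdge H (W ∪ B) then (1 : ℝ) else 0 := by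
      refine subsetExp_mono h0 h1 _ fun B => ?_
      split_ifs with hA hB hB
      · exact le_rfl
      · obtain ⟨T, hT, hTB⟩ := hA
        obtain ⟨S, hS, rfl⟩ := Finset.mem_image.1
          (Finset.mem_filter.1 (Finset.mem_filter.1 hT).1).1
        exact absurd ⟨S, hS, sdiff_le_iff.1 hTB⟩ hB
      · exact zero_le_one
      · exact le_rfl
    linarith
  have havg := subsetExp_mono hp.le hp1 univ hround
  rw [subsetExp_const, subsetExp_add, subsetExp_union p p' univ
    (fun W => if HasEdge H W then (1 : ℝ) else 0)] at havg
  change coverCost q H + -e' ≤ hitProb (p + p' - p * p') H + subsetExp p univ g at havg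
  linarith

theorem coverCost_le_hitProb_zero (q : ℝ) (H : Finset (Finset β))
    (hH : ∀ S ∈ H, S.card ≤ 0) : coverCost q H ≤ hitProb 0 H := by
  rcases H.eq_empty_or_nonempty with rfl | ⟨S, hS⟩
  · have h1 : coverCost q (∅ : Finset (Finset β)) ≤ 0 := by
      simpa using coverCost_le (q := q) (G := ∅) (H := (∅ : Finset (Finset β)))
        fun S hS => absurd hS (Finset.notMem_empty S)
    refine h1.trans ?_
    have := subsetExp_mono (β := β) le_rfl zero_le_one univ (f := fun _ => 0)
      (g := fun W => if HasEdge ∅ W then (1 : ℝ) else 0) fun W => by split_ifs <;> norm_num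
    rwa [subsetExp_const] at this
  · have hS0 : S = ∅ := Finset.card_eq_zero.1 (Nat.le_zero.1 (hH S hS))
    subst hS0
    have h1 : coverCost q H ≤ 1 := by
      simpa using coverCost_le (q := q) (isCover_singleton_empty H)
    have hE : ∀ W, HasEdge H W := fun W => ⟨∅, hS, Finset.empty_subset W⟩
    simpa [hitProb, hE, subsetExp_const] using h1

end cover

theorem sum_powerset_pow_card {β : Type*} (δ : ℝ) (S : Finset β) :
    ∑ T ∈ S.powerset, δ ^ T.card = (1 + δ) ^ S.card := by
  have := Finset.sum_pow_mul_eq_add_pow δ 1 S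
  simpa [add_comm] using this

theorem sum_powerset_pos_card_le {β : Type*} {δ : ℝ} (hδ : 0 ≤ δ) {M : ℕ} {S : Finset β}
    (hS : S.card ≤ M) :
    ∑ T ∈ S.powerset with 0 < T.card, δ ^ T.card ≤ (1 + δ) ^ M - 1 := by
  have h := Finset.sum_filter_add_sum_filter_not S.powerset (fun T => 0 < T.card)
    fun T => δ ^ T.card
  rw [sum_powerset_pow_card] at h
  have h1 : (1 : ℝ) ≤ ∑ T ∈ S.powerset with ¬ 0 < T.card, δ ^ T.card := by
    have hmem : (∅ : Finset β) ∈ S.powerset.filter fun T => ¬ 0 < T.card := by simp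
    simpa using Finset.single_le_sum (f := fun T : Finset β => δ ^ T.card)
      (fun T _ => by positivity) hmem
  have h2 : (1 + δ) ^ S.card ≤ (1 + δ) ^ M := pow_le_pow_right₀ (by linarith) hS
  linarith

theorem sum_powerset_large_card_le {β : Type*} {m : ℕ} {S : Finset β} (hS : S.card ≤ 2 * m) :
    ∑ T ∈ S.powerset with m < T.card, (1 / 8 : ℝ) ^ T.card ≤ (1 / 2) ^ m := by
  calc ∑ T ∈ S.powerset with m < T.card, (1 / 8 : ℝ) ^ T.card
      ≤ ∑ T ∈ S.powerset with m < T.card, (1 / 8 : ℝ) ^ m :=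
        Finset.sum_le_sum fun T hT => pow_le_pow_of_le_one (by norm_num) (by norm_num)
          (Finset.mem_filter.1 hT).2.le
    _ ≤ ∑ T ∈ S.powerset, (1 / 8 : ℝ) ^ m :=
        Finset.sum_le_sum_of_subset_of_nonneg (Finset.filter_subset _ _)
          fun _ _ _ => by positivity
    _ = 2 ^ S.card * (1 / 8 : ℝ) ^ m := by simp
    _ ≤ 2 ^ (2 * m) * (1 / 8 : ℝ) ^ m := by
        gcongr
        norm_num
    _ = (1 / 2) ^ m := by
        rw [pow_mul, ← mul_pow]
        norm_num

/-- Halving the edge size `n` times, then one final round of density `p₀`. -/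
theorem coverCost_sub_le_hitProb {β : Type*} [Fintype β] [DecidableEq β] {q p₀ : ℝ} {M : ℕ}
    (hq : 0 < q) (hp₀ : 0 < p₀) (hM : 1 ≤ M) (n : ℕ) (hle : 8 * q * n + p₀ ≤ 1)
    (H : Finset (Finset β)) (hH : ∀ S ∈ H, S.card ≤ 2 ^ n * M) :
    coverCost q H - ((1 + q / p₀) ^ M - 1 + (1 / 2) ^ M * (2 - 2 * (1 / 2) ^ n)) ≤
      hitProb (8 * q * n + p₀) H := by
  induction n generalizing H with
  | zero =>
    have he : 0 ≤ (1 + q / p₀) ^ M - 1 := by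
      have : 0 ≤ q / p₀ := by positivity
      have := one_le_pow₀ (n := M) (show 1 ≤ 1 + q / p₀ by linarith)
      linarith
    have := coverCost_sub_le_hitProb_of_round (e' := 0) hp₀ (by simpa using hle) hq.le he le_rfl
      (by simpa using hle) 0 (fun H hH => by simpa using coverCost_le_hitProb_zero q H hH) H
      fun S hS => sum_powerset_pos_card_le (by positivity) (by simpa using hH S hS)
    simpa using this
  | succ n ih =>
    push_cast at hle
    have hn : (0 : ℝ) ≤ 8 * q * n := by positivity
    have hm : M + n ≤ 2 ^ n * M := by
      have := Nat.lt_two_pow_self (n := n)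
      nlinarith
    have h8 : q / (8 * q) = 1 / 8 := by field_simp
    have := coverCost_sub_le_hitProb_of_round (p := 8 * q) (p' := 8 * q * n + p₀)
      (e := (1 / 2) ^ (M + n)) (by positivity) (by linarith) hq.le (by positivity)
      (by positivity) (by linarith) (2 ^ n * M) (ih (by linarith)) H fun S hS => by
        rw [h8]
        refine (sum_powerset_large_card_le ?_).trans
          (pow_le_pow_of_le_one (by norm_num) (by norm_num) hm)
        have := hH S hS
        rw [pow_succ] at this
        linarith
    convert this using 2
    · rw [pow_add, pow_succ]
      ring
    · push_cast
      ring

/-- A hypergraph whose edges have size at most `2 ^ n` and all of whose covers cost at least `1`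
is hit with high probability at density `16 n q`. -/
theorem one_sub_le_hitProb {β : Type*} [Fintype β] [DecidableEq β] {q p : ℝ} {n : ℕ}
    (hq : 0 < q) (hn : 1 ≤ n) (hp : 16 * n * q ≤ p) (hp1 : p ≤ 1) (H : Finset (Finset β))
    (hH : ∀ S ∈ H, S.card ≤ 2 ^ n)
    (hcost : ∀ G, IsCover G H → 1 ≤ ∑ T ∈ G, q ^ T.card) :
    1 - (Real.exp (1 / (Nat.sqrt n : ℝ)) - 1 + 2 * (1 / 2) ^ Nat.sqrt n) ≤ hitProb p H := by
  obtain ⟨M, hM⟩ : ∃ M, M = Nat.sqrt n := ⟨_, rfl⟩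
  have hM1 : 1 ≤ M := by rw [hM]; exact Nat.sqrt_pos.2 hn
  have hMn : M * M ≤ n := by rw [hM]; exact Nat.sqrt_le n
  rw [← hM]
  have hnR : (1 : ℝ) ≤ n := by exact_mod_cast hn
  have hMR : (1 : ℝ) ≤ M := by exact_mod_cast hM1
  have hMnR : (M : ℝ) * M ≤ n := by exact_mod_cast hMn
  have hp₀ : 0 < 8 * q * n := by positivity
  have h := coverCost_sub_le_hitProb hq hp₀ hM1 n (by linarith) H
    fun S hS => (hH S hS).trans (Nat.le_mul_of_pos_right _ hM1)
  have hmono := hitProb_mono (p := 8 * q * n + 8 * q * n) (by positivity) (by linarith) hp1 H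
  have hc : 1 ≤ coverCost q H := by
    obtain ⟨G, hG, h⟩ := exists_isCover_coverCost q H
    rw [h]
    exact hcost G hG
  have hexp : (1 + q / (8 * q * n)) ^ M ≤ Real.exp (1 / (M : ℝ)) := by
    calc (1 + q / (8 * q * n)) ^ M ≤ Real.exp (q / (8 * q * n)) ^ M := by
          gcongr
          linarith [Real.add_one_le_exp (q / (8 * q * n))]
      _ = Real.exp (M * (q / (8 * q * n))) := (Real.exp_nat_mul _ _).symm
      _ ≤ _ := by
          gcongr
          have : M * (q / (8 * q * n)) = M / (8 * n) := by field_simp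
          rw [this, div_le_div_iff₀ (by positivity) (by positivity)]
          linarith
  have hsq : 0 ≤ (1 / 2 : ℝ) ^ M * (2 * (1 / 2) ^ n) := by positivity
  linarith

theorem pow_mul_factorial_sub_le {t k : ℕ} (ht : t ≤ k) :
    (k : ℝ) ^ t * ((k - t).factorial : ℝ) ≤ 3 ^ t * (k.factorial : ℝ) := by
  have hdesc : k ^ t * t.factorial ≤ k.descFactorial t * t ^ t := by
    rw [← Nat.descFactorial_self t, Nat.descFactorial_eq_prod_range,
      Nat.descFactorial_eq_prod_range]
    calc k ^ t * ∏ i ∈ Finset.range t, (t - i)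
        = ∏ i ∈ Finset.range t, k * (t - i) := by simp [Finset.prod_mul_distrib]
      _ ≤ ∏ i ∈ Finset.range t, (k - i) * t := by
          refine Finset.prod_le_prod' fun i _ => ?_
          rw [Nat.mul_sub, Nat.sub_mul]
          have : i * t ≤ k * i := by nlinarith
          omega
      _ = _ := by simp [Finset.prod_mul_distrib]
  have hfact : (k - t).factorial * k.descFactorial t = k.factorial :=
    Nat.factorial_mul_descFactorial ht
  have hpow : (t : ℝ) ^ t ≤ 3 ^ t * t.factorial := by
    have h1 := Real.pow_div_factorial_le_exp (t : ℝ) (by positivity) t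
    rw [div_le_iff₀ (by positivity)] at h1
    have h2 : Real.exp t ≤ 3 ^ t := by
      rw [← mul_one (t : ℝ), Real.exp_nat_mul]
      gcongr
      exact Real.exp_one_lt_three.le
    exact h1.trans (by gcongr)
  have hdescR : (k : ℝ) ^ t * t.factorial ≤ k.descFactorial t * t ^ t := by
    exact_mod_cast hdesc
  have hmain : (k : ℝ) ^ t ≤ 3 ^ t * k.descFactorial t := by
    have ht0 : (0 : ℝ) < t.factorial := by positivity
    refine le_of_mul_le_mul_right (hdescR.trans ?_) ht0
    calc (k.descFactorial t : ℝ) * t ^ t ≤ k.descFactorial t * (3 ^ t * t.factorial) := by gcongr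
      _ = _ := by ring
  rw [← hfact]
  push_cast
  calc (k : ℝ) ^ t * (k - t).factorial ≤ 3 ^ t * k.descFactorial t * (k - t).factorial := by
        gcongr
    _ = _ := by ring

theorem card_perm_agree_le {γ : Type*} [Fintype γ] [DecidableEq γ] (A : Finset γ)
    (σ₀ : Equiv.Perm γ) :
    (univ.filter fun σ : Equiv.Perm γ => ∀ a ∈ A, σ a = σ₀ a).card ≤
      (Fintype.card γ - A.card).factorial := by
  have hcard : Fintype.card {τ : Equiv.Perm γ // ∀ a, ¬ a ∉ A → τ a = a} =
      (Fintype.card γ - A.card).factorial := by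
    rw [← Fintype.card_congr (Equiv.Perm.subtypeEquivSubtypePerm (· ∉ A)), Fintype.card_perm]
    congr 1
    rw [Fintype.card_subtype_compl, Fintype.card_coe]
  rw [← hcard, Fintype.card_subtype]
  refine Finset.card_le_card_of_injOn (fun σ => σ₀⁻¹ * σ) (fun σ hσ => ?_)
    fun σ _ τ _ h => mul_left_cancel h
  have hσ' := (Finset.mem_filter.1 hσ).2
  refine Finset.mem_coe.2 (Finset.mem_filter.2 ⟨Finset.mem_univ _, fun a ha => ?_⟩)
  rw [Equiv.Perm.mul_apply, hσ' a (not_not.1 ha)]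
  exact σ₀.symm_apply_apply a

/-- The graph over `E` of the colouring `σ ∘ e`. -/
def coloredEdge {α γ : Type*} [DecidableEq α] [DecidableEq γ] (e : α → γ) (E : Finset α)
    (σ : Equiv.Perm γ) : Finset (α × γ) :=
  E.image fun x => (x, σ (e x))

section coloredEdge

variable {α γ : Type*} [DecidableEq α] [DecidableEq γ] {e : α → γ} {E : Finset α}
  {σ : Equiv.Perm γ}

theorem image_fst_coloredEdge : (coloredEdge e E σ).image Prod.fst = E := by
  simp [coloredEdge, Finset.image_image, Function.comp_def]

theorem card_coloredEdge : (coloredEdge e E σ).card = E.card :=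
  Finset.card_image_of_injective _ fun _ _ h => (Prod.mk.inj h).1

theorem card_image_snd_coloredEdge (he : Set.InjOn e E) :
    ((coloredEdge e E σ).image Prod.snd).card = (coloredEdge e E σ).card := by
  rw [card_coloredEdge, coloredEdge, Finset.image_image]
  exact Finset.card_image_of_injOn fun x hx y hy h => he hx hy (σ.injective h)

theorem injOn_fst_of_subset_coloredEdge {T : Finset (α × γ)} (hT : T ⊆ coloredEdge e E σ) :
    Set.InjOn Prod.fst (T : Set (α × γ)) := by
  intro a ha b hb h
  obtain ⟨x, -, rfl⟩ := Finset.mem_image.1 (hT ha)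
  obtain ⟨y, -, rfl⟩ := Finset.mem_image.1 (hT hb)
  simp only at h
  rw [h]

theorem card_filter_subset_coloredEdge_le [Fintype γ] (he : Set.InjOn e E)
    (T : Finset (α × γ)) :
    (univ.filter fun σ => T ⊆ coloredEdge e E σ).card ≤
      (Fintype.card γ - T.card).factorial := by
  rcases (univ.filter fun σ => T ⊆ coloredEdge e E σ).eq_empty_or_nonempty with h | ⟨σ₀, hσ₀⟩
  · simp [h]
  replace hσ₀ := (Finset.mem_filter.1 hσ₀).2
  have hval : ∀ σ, T ⊆ coloredEdge e E σ → ∀ a ∈ T, a.1 ∈ E ∧ σ (e a.1) = a.2 := by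
    intro σ hσ a ha
    obtain ⟨x, hx, rfl⟩ := Finset.mem_image.1 (hσ ha)
    exact ⟨hx, rfl⟩
  have hcard : (T.image fun a => e a.1).card = T.card :=
    Finset.card_image_of_injOn fun a ha b hb h =>
      injOn_fst_of_subset_coloredEdge hσ₀ ha hb
        (he (hval σ₀ hσ₀ a ha).1 (hval σ₀ hσ₀ b hb).1 h)
  rw [← hcard]
  refine (Finset.card_le_card fun σ hσ => ?_).trans (card_perm_agree_le _ σ₀)
  refine Finset.mem_filter.2 ⟨Finset.mem_univ _, fun c hc => ?_⟩
  obtain ⟨a, ha, rfl⟩ := Finset.mem_image.1 hc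
  rw [(hval σ (Finset.mem_filter.1 hσ).2 a ha).2, (hval σ₀ hσ₀ a ha).2]

end coloredEdge

theorem exists_injOn_fin {α : Type*} {k : ℕ} (hk : 0 < k) (E : Finset α) (hE : E.card ≤ k) :
    ∃ e : α → Fin k, Set.InjOn e E := by
  have : Nonempty (Fin k) := ⟨⟨0, hk⟩⟩
  obtain ⟨e, -, he⟩ := E.finite_toSet.exists_injOn_of_encard_le (t := (Set.univ : Set (Fin k)))
    (by simpa using hE)
  exact ⟨e, he⟩

/-- The edges of `H` coloured injectively by the permutations of a reference colouring. -/
noncomputable def transversals {α : Type*} [DecidableEq α] {k : ℕ} (e : Finset α → α → Fin k)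
    (H : Multiset (Finset α)) : Finset (Finset (α × Fin k)) :=
  H.toFinset.biUnion fun E => univ.image (coloredEdge (e E) E)

theorem mem_transversals {α : Type*} [DecidableEq α] {k : ℕ} {e : Finset α → α → Fin k}
    {H : Multiset (Finset α)} {S : Finset (α × Fin k)} :
    S ∈ transversals e H ↔ ∃ E ∈ H, ∃ σ, coloredEdge (e E) E σ = S := by
  simp [transversals]

theorem sum_count_filter {γ : Type*} [DecidableEq γ] (H : Multiset γ) (P : γ → Prop)
    [DecidablePred P] :
    ∑ E ∈ H.toFinset, (if P E then (H.count E : ℝ) else 0) = (H.filter P).card := by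
  rw [← Multiset.toFinset_sum_count_eq (H.filter P), Multiset.toFinset_filter, Nat.cast_sum,
    Finset.sum_filter]
  refine Finset.sum_congr rfl fun E _ => ?_
  split_ifs with h
  · rw [Multiset.count_filter_of_pos h]
  · rfl

/-- The transversals of a `κ`-spread hypergraph inherit a spread of order `κ k`, so covers are
expensive. -/
theorem one_le_cost_of_isCover_transversals {α : Type*} [DecidableEq α] {k : ℕ} {κ : ℝ}
    {H : Multiset (Finset α)} {e : Finset α → α → Fin k} (hk : 0 < k) (hκ : 0 < κ) (hH : H ≠ 0)
    (hcard : ∀ E ∈ H, E.card ≤ k) (he : ∀ E ∈ H, Set.InjOn (e E) E) (hs : Spread κ H)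
    {G : Finset (Finset (α × Fin k))} (hG : IsCover G (transversals e H)) :
    1 ≤ ∑ T ∈ G, (3 / (κ * k)) ^ T.card := by
  have hkR : (0 : ℝ) < k := by exact_mod_cast hk
  have hHpos : (0 : ℝ) < H.card := by exact_mod_cast Multiset.card_pos.2 hH
  have hfac : (0 : ℝ) < k.factorial := by positivity
  set N : Finset (α × Fin k) → Finset α → ℝ := fun T E =>
    ((univ.filter fun σ => T ⊆ coloredEdge (e E) E σ).card : ℝ) with hN
  have hbound : ∀ T, ∑ E ∈ H.toFinset, (H.count E : ℝ) * N T E ≤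
      (3 / (κ * k)) ^ T.card * (k.factorial * H.card) := by
    intro T
    by_cases hT : (T.image Prod.fst).card = T.card ∧ T.card ≤ k
    · have hterm : ∀ E ∈ H.toFinset, (H.count E : ℝ) * N T E ≤
          (if T.image Prod.fst ⊆ E then (H.count E : ℝ) else 0) * (k - T.card).factorial := by
        intro E hE
        split_ifs with hTE
        · gcongr
          have := card_filter_subset_coloredEdge_le (he E (Multiset.mem_toFinset.1 hE)) T
          rw [Fintype.card_fin] at this
          simp only [hN]
          exact_mod_cast this
        · have : N T E = 0 := by
            simp only [hN, Nat.cast_eq_zero, Finset.card_eq_zero]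
            refine Finset.filter_eq_empty_iff.2 fun σ _ hσ => hTE ?_
            have := Finset.image_subset_image (f := Prod.fst) hσ
            rwa [image_fst_coloredEdge] at this
          simp [this]
      calc ∑ E ∈ H.toFinset, (H.count E : ℝ) * N T E
          ≤ ∑ E ∈ H.toFinset, (if T.image Prod.fst ⊆ E then (H.count E : ℝ) else 0) *
              (k - T.card).factorial := Finset.sum_le_sum hterm
        _ ≤ κ⁻¹ ^ T.card * H.card * (k - T.card).factorial := by
            rw [← Finset.sum_mul, sum_count_filter]
            gcongr
            rw [← hT.1]
            convert hs (T.image Prod.fst)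
        _ ≤ _ := by
            have h := pow_mul_factorial_sub_le hT.2
            have h' : ((k - T.card).factorial : ℝ) ≤ (3 / k) ^ T.card * k.factorial := by
              rw [div_pow, div_mul_eq_mul_div, le_div_iff₀ (by positivity)]
              linarith
            calc κ⁻¹ ^ T.card * H.card * ((k - T.card).factorial : ℝ)
                ≤ κ⁻¹ ^ T.card * H.card * ((3 / k) ^ T.card * k.factorial) := by gcongr
              _ = (κ⁻¹ * (3 / k)) ^ T.card * (k.factorial * H.card) := by rw [mul_pow]; ring
              _ = _ := by
                  congr 2
                  field_simp
    · have hzero : ∀ E ∈ H.toFinset, (H.count E : ℝ) * N T E = 0 := by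
        intro E hE
        have : N T E = 0 := by
          simp only [hN, Nat.cast_eq_zero, Finset.card_eq_zero]
          refine Finset.filter_eq_empty_iff.2 fun σ _ hσ => hT ⟨?_, ?_⟩
          · exact Finset.card_image_of_injOn (injOn_fst_of_subset_coloredEdge hσ)
          · refine (Finset.card_le_card hσ).trans ?_
            rw [card_coloredEdge]
            exact hcard E (Multiset.mem_toFinset.1 hE)
        rw [this, mul_zero]
      rw [Finset.sum_eq_zero hzero]
      positivity
  have hcover : ∀ E ∈ H.toFinset, (k.factorial : ℝ) ≤ ∑ T ∈ G, N T E := by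
    intro E hE
    have hsub : (univ : Finset (Equiv.Perm (Fin k))) ⊆
        G.biUnion fun T => univ.filter fun σ => T ⊆ coloredEdge (e E) E σ := by
      intro σ _
      obtain ⟨T, hT, hTσ⟩ := hG (coloredEdge (e E) E σ)
        (mem_transversals.2 ⟨E, Multiset.mem_toFinset.1 hE, σ, rfl⟩)
      exact Finset.mem_biUnion.2 ⟨T, hT, Finset.mem_filter.2 ⟨Finset.mem_univ _, hTσ⟩⟩
    have := (Finset.card_le_card hsub).trans Finset.card_biUnion_le
    rw [Finset.card_univ, Fintype.card_perm, Fintype.card_fin] at this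
    simp only [hN]
    exact_mod_cast this
  have htotal : (H.card : ℝ) = ∑ E ∈ H.toFinset, (H.count E : ℝ) := by
    exact_mod_cast (Multiset.toFinset_sum_count_eq H).symm
  have hmain : (k.factorial * H.card : ℝ) ≤
      (∑ T ∈ G, (3 / (κ * k)) ^ T.card) * (k.factorial * H.card) := by
    calc (k.factorial * H.card : ℝ)
        = ∑ E ∈ H.toFinset, (H.count E : ℝ) * k.factorial := by
          rw [← Finset.sum_mul, ← htotal, mul_comm]
      _ ≤ ∑ E ∈ H.toFinset, (H.count E : ℝ) * ∑ T ∈ G, N T E :=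
          Finset.sum_le_sum fun E hE => mul_le_mul_of_nonneg_left (hcover E hE) (by positivity)
      _ = ∑ T ∈ G, ∑ E ∈ H.toFinset, (H.count E : ℝ) * N T E := by
          simp only [Finset.mul_sum]
          exact Finset.sum_comm
      _ ≤ ∑ T ∈ G, (3 / (κ * k)) ^ T.card * (k.factorial * H.card) :=
          Finset.sum_le_sum fun T _ => hbound T
      _ = _ := (Finset.sum_mul _ _ _).symm
  exact (le_mul_iff_one_le_left (by positivity)).1 hmain

theorem hitProb_transversals_le_transProb {α : Type*} [Fintype α] [DecidableEq α] {k : ℕ}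
    {q : ℝ} (h0 : 0 ≤ q) (h1 : q ≤ 1) {H : Multiset (Finset α)} {e : Finset α → α → Fin k}
    (he : ∀ E ∈ H, Set.InjOn (e E) E) : hitProb q (transversals e H) ≤ transProb k q H := by
  have h1' : 0 ≤ 1 - q := by linarith
  unfold hitProb subsetExp transProb
  rw [Finset.powerset_univ]
  refine Finset.sum_le_sum fun W _ => ?_
  rw [Finset.card_univ]
  refine mul_le_mul_of_nonneg_left ?_ (by positivity)
  beta_reduce
  by_cases hW : HasEdge (transversals e H) W
  · obtain ⟨S, hS, hSW⟩ := hW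
    obtain ⟨E, hE, σ, rfl⟩ := mem_transversals.1 hS
    rw [if_pos ⟨_, hS, hSW⟩, if_pos]
    refine ⟨_, hSW, ?_, ?_, card_image_snd_coloredEdge (he E hE)⟩
    · rwa [image_fst_coloredEdge]
    · rw [image_fst_coloredEdge, card_coloredEdge]
  · rw [if_neg hW]
    split_ifs <;> norm_num

/-- The failure probability for edges of size at most `r`. -/
noncomputable def spreadError (r : ℕ) : ℝ :=
  Real.exp (1 / (Nat.sqrt (Nat.clog 2 r) : ℝ)) - 1 + 2 * (1 / 2) ^ Nat.sqrt (Nat.clog 2 r)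

theorem spreadError_nonneg (r : ℕ) : 0 ≤ spreadError r := by
  have : (1 : ℝ) ≤ Real.exp (1 / (Nat.sqrt (Nat.clog 2 r) : ℝ)) :=
    Real.one_le_exp (by positivity)
  have h2 : (0 : ℝ) ≤ 2 * (1 / 2) ^ Nat.sqrt (Nat.clog 2 r) := by positivity
  unfold spreadError
  linarith

theorem tendsto_spreadError : Filter.Tendsto spreadError Filter.atTop (nhds 0) := by
  have hM : Filter.Tendsto (fun r => Nat.sqrt (Nat.clog 2 r)) Filter.atTop Filter.atTop := by
    refine Filter.tendsto_atTop_atTop.2 fun b => ⟨2 ^ (b * b), fun r hr => ?_⟩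
    rw [Nat.le_sqrt]
    have := Nat.clog_mono_right 2 hr
    rwa [Nat.clog_pow 2 _ (by norm_num)] at this
  have h : Filter.Tendsto (fun M : ℕ => Real.exp (1 / (M : ℝ)) - 1 + 2 * (1 / 2) ^ M)
      Filter.atTop (nhds 0) := by
    have h1 := (Real.continuous_exp.tendsto 0).comp (tendsto_one_div_atTop_nhds_zero_nat (𝕜 := ℝ))
    have h2 := tendsto_pow_atTop_nhds_zero_of_lt_one (r := (1 / 2 : ℝ)) (by norm_num)
      (by norm_num)
    simpa using (h1.sub_const 1).add (h2.const_mul 2)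
  exact h.comp hM

theorem clog_two_le_three_mul_log {r : ℕ} (hr : 2 ≤ r) :
    (Nat.clog 2 r : ℝ) ≤ 3 * Real.log r := by
  have hlog2 := Real.log_two_gt_d9
  have hn : 1 ≤ Nat.clog 2 r := Nat.clog_pos (by norm_num) hr
  have hlt : 2 ^ (Nat.clog 2 r - 1) < r := Nat.pow_pred_clog_lt_self (by norm_num) hr
  have hltR : ((2 : ℝ) ^ (Nat.clog 2 r - 1)) ≤ r := by exact_mod_cast hlt.le
  have h1 := Real.log_le_log (by positivity) hltR
  rw [Real.log_pow, Nat.cast_sub hn] at h1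
  have h2 : Real.log 2 ≤ Real.log r := Real.log_le_log (by norm_num) (by exact_mod_cast hr)
  have hnR : (1 : ℝ) ≤ Nat.clog 2 r := by exact_mod_cast hn
  push_cast at h1
  nlinarith

/-- There are an absolute constant `C > 0` and `ε : ℕ → [0,1]` with `ε(r) → 0` such that:
for every `r`-bounded `κ`-spread multi-hypergraph `H` with `r ≥ 2`, every `k ≥ r`, and
every `C log r / κ ≤ p ≤ 1`, with probability at least `1 - ε(r)` the random subset
`X'_{p/k}` of `X' = X × [k]` contains a set `{(x₁,i₁),…,(x_t,i_t)}` with `{x₁,…,x_t}` an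
edge of `H` and `i₁,…,i_t` pairwise distinct. -/
theorem transversal_spread_threshold :
    ∃ C : ℝ, 0 < C ∧ ∃ ε : ℕ → ℝ, (∀ r, 0 ≤ ε r ∧ ε r ≤ 1) ∧
      Filter.Tendsto ε Filter.atTop (nhds 0) ∧
      ∀ (α : Type) [Fintype α] [DecidableEq α],
        ∀ (H : Multiset (Finset α)) (r k : ℕ) (κ p : ℝ),
          2 ≤ r → 0 < κ → H ≠ 0 → (∀ E ∈ H, E.card ≤ r) → Spread κ H → r ≤ k →
          C * Real.log r / κ ≤ p → p ≤ 1 →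
          1 - ε r ≤ transProb k (p / (k : ℝ)) H := by
  refine ⟨144, by norm_num, fun r => min 1 (spreadError r), fun r =>
    ⟨le_min zero_le_one (spreadError_nonneg r), min_le_left _ _⟩, ?_, ?_⟩
  · simpa using (tendsto_const_nhds (x := (1 : ℝ))).min tendsto_spreadError
  intro α _ _ H r k κ p hr hκ hH hcard hs hrk hp hp1
  have hk : 0 < k := by omega
  have hkR : (1 : ℝ) ≤ k := by exact_mod_cast hk
  have hcardk : ∀ E ∈ H, E.card ≤ k := fun E hE => (hcard E hE).trans hrk
  have hex : ∀ E : Finset α, ∃ e : α → Fin k, E ∈ H → Set.InjOn e E := fun E => by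
    by_cases hE : E ∈ H
    · obtain ⟨e, he⟩ := exists_injOn_fin hk E (hcardk E hE)
      exact ⟨e, fun _ => he⟩
    · exact ⟨fun _ => ⟨0, hk⟩, fun h => absurd h hE⟩
  choose e he using hex
  have hn : 1 ≤ Nat.clog 2 r := Nat.clog_pos (by norm_num) hr
  have hlog := clog_two_le_three_mul_log hr
  have hlog0 : 0 ≤ Real.log r := Real.log_natCast_nonneg r
  have hp0 : 0 ≤ p := le_trans (by positivity) hp
  have hq1 : p / k ≤ 1 := (div_le_one (by linarith)).2 (hp1.trans hkR)
  have hdensity : 16 * (Nat.clog 2 r : ℝ) * (3 / (κ * k)) ≤ p / k := by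
    rw [div_le_iff₀ hκ] at hp
    rw [mul_div_assoc', div_le_div_iff₀ (by positivity) (by positivity)]
    nlinarith
  have hhit := one_sub_le_hitProb (q := 3 / (κ * k)) (by positivity) hn hdensity hq1
    (transversals e H)
    (fun S hS => by
      obtain ⟨E, hE, σ, rfl⟩ := mem_transversals.1 hS
      rw [card_coloredEdge]
      exact (hcard E hE).trans (Nat.le_pow_clog (by norm_num) r))
    fun G hG => one_le_cost_of_isCover_transversals hk hκ hH hcardk he hs hG
  have htrans := hhit.trans (hitProb_transversals_le_transProb (by positivity) hq1 he)
  change 1 - spreadError r ≤ _ at htrans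
  have hnonneg : 0 ≤ transProb k (p / k) H := by
    have h1 : 0 ≤ 1 - p / k := by linarith
    have h0 : 0 ≤ p / k := by positivity
    exact Finset.sum_nonneg fun W _ => mul_nonneg (by positivity) (by split_ifs <;> norm_num)
  beta_reduce
  rcases min_choice 1 (spreadError r) with h | h <;> rw [h] <;> linarith
end

section
/- Let H be an r-bounded κ-spread multi-hypergraph on a finite set X, let k ≥ r be an integer, and let X' = X × [k]. Define the multi-hypergraph H'' on X' as follows: for each edge E = {x₁,…,x_t} of H (counted with its multiplicity m_H(E)) and each choice of pairwise distinct colors i₁,…,i_t ∈ [k], include the set {(x₁,i₁),…,(x_t,i_t)} in H'' with multiplicity m_H(E) · (k−t)_{r−t}, where (a)_b := a(a−1)⋯(a−b+1) denotes the falling factorial. Then |H''| = (k)_r · |H|, and H'' is (kκ/e)-spread. -/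
open Finset
open scoped Classical

/-- The multi-hypergraph `H''` on `X' = X × [k]`: for each edge `E = {x₁,…,x_t}` of `H`
(with multiplicity) and each choice of pairwise distinct colors `i₁,…,i_t ∈ [k]`,
it contains the set `{(x₁,i₁),…,(x_t,i_t)}` with multiplicity `(k-t)_{r-t}` times the
multiplicity of `E` in `H`. -/
noncomputable def coloredExt {α : Type*} [Fintype α] [DecidableEq α] (k r : ℕ)
    (H : Multiset (Finset α)) : Multiset (Finset (α × Fin k)) :=
  H.bind fun E =>
    Nat.descFactorial (k - E.card) (r - E.card) •
      (Finset.univ.filter fun S : Finset (α × Fin k) =>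
        S.image Prod.fst = E ∧ S.card = E.card ∧ (S.image Prod.snd).card = S.card).val

/-- The number of properly coloured copies of `E` containing a fixed properly coloured copy `S` of a
subset of `E`. -/
theorem card_coloredCopies_superset {α : Type*} [Fintype α] [DecidableEq α] {k : ℕ}
    (E : Finset α) (n : ℕ) (S : Finset (α × Fin k))
    (h₁ : Set.InjOn Prod.fst (S : Set (α × Fin k)))
    (h₂ : Set.InjOn Prod.snd (S : Set (α × Fin k)))
    (hSE : S.image Prod.fst ⊆ E) (hn : E.card = S.card + n) :
    (Finset.univ.filter fun T : Finset (α × Fin k) =>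
      (T.image Prod.fst = E ∧ T.card = E.card ∧ (T.image Prod.snd).card = T.card) ∧
        S ⊆ T).card = (k - S.card).descFactorial n := by
  induction n generalizing S with
  | zero =>
    have hE : S.image Prod.fst = E :=
      Finset.eq_of_subset_of_card_le hSE (by rw [Finset.card_image_of_injOn h₁]; omega)
    rw [Nat.descFactorial_zero, Finset.card_eq_one]
    refine ⟨S, ?_⟩
    ext T
    simp only [Finset.mem_filter, Finset.mem_univ, true_and, Finset.mem_singleton]
    constructor
    · rintro ⟨⟨-, hT, -⟩, hST⟩
      exact (Finset.eq_of_subset_of_card_le hST (by omega)).symm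
    · rintro rfl
      exact ⟨⟨hE, by omega, Finset.card_image_of_injOn h₂⟩, subset_rfl⟩
  | succ n ih =>
    have hlt : (S.image Prod.fst).card < E.card := by
      rw [Finset.card_image_of_injOn h₁]; omega
    obtain ⟨x, hxE, hxS⟩ := Finset.exists_mem_notMem_of_card_lt_card hlt
    have hx : ∀ j, (x, j) ∉ S := fun j hj => hxS (Finset.mem_image_of_mem Prod.fst hj)
    have hsplit : (Finset.univ.filter fun T : Finset (α × Fin k) =>
        (T.image Prod.fst = E ∧ T.card = E.card ∧ (T.image Prod.snd).card = T.card) ∧ S ⊆ T) =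
        (Finset.univ \ S.image Prod.snd).biUnion fun i =>
          Finset.univ.filter fun T : Finset (α × Fin k) =>
            (T.image Prod.fst = E ∧ T.card = E.card ∧ (T.image Prod.snd).card = T.card) ∧
              insert (x, i) S ⊆ T := by
      ext T
      simp only [Finset.mem_filter, Finset.mem_univ, true_and, Finset.mem_biUnion,
        Finset.mem_sdiff, Finset.insert_subset_iff]
      constructor
      · rintro ⟨hT, hST⟩
        obtain ⟨⟨y, i⟩, hyT, rfl⟩ := Finset.mem_image.1 (hT.1 ▸ hxE : x ∈ T.image Prod.fst)
        refine ⟨i, fun hi => ?_, hT, hyT, hST⟩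
        obtain ⟨p, hp, hpi⟩ := Finset.mem_image.1 hi
        have := Finset.card_image_iff.1 hT.2.2 (hST hp) hyT hpi
        exact hx i (this ▸ hp)
      · rintro ⟨i, -, hT, -, hST⟩
        exact ⟨hT, hST⟩
    have hcard : (Finset.univ \ S.image Prod.snd : Finset (Fin k)).card = k - S.card := by
      rw [Finset.card_sdiff_of_subset (Finset.subset_univ _), Finset.card_image_of_injOn h₂,
        Finset.card_univ, Fintype.card_fin]
    have hterm : ∀ i ∈ (Finset.univ \ S.image Prod.snd : Finset (Fin k)),
        (Finset.univ.filter fun T : Finset (α × Fin k) =>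
          (T.image Prod.fst = E ∧ T.card = E.card ∧ (T.image Prod.snd).card = T.card) ∧
            insert (x, i) S ⊆ T).card = (k - S.card - 1).descFactorial n := by
      intro i hi
      have hi' : i ∉ S.image Prod.snd := (Finset.mem_sdiff.1 hi).2
      have hc : (insert (x, i) S).card = S.card + 1 := Finset.card_insert_of_notMem (hx i)
      rw [ih (insert (x, i) S), hc, Nat.sub_sub]
      · rw [Finset.coe_insert, Set.injOn_insert (by simpa using hx i)]
        exact ⟨h₁, by simpa using hx⟩
      · rw [Finset.coe_insert, Set.injOn_insert (by simpa using hx i)]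
        exact ⟨h₂, by simpa using hi'⟩
      · rw [Finset.image_insert]
        exact Finset.insert_subset hxE hSE
      · omega
    rw [hsplit, Finset.card_biUnion, Finset.sum_congr rfl hterm, Finset.sum_const, hcard,
      smul_eq_mul]
    · rcases k - S.card with _ | m
      · simp
      · rw [Nat.succ_descFactorial_succ, Nat.add_sub_cancel]
    · intro i _ j _ hij
      rw [Function.onFun, Finset.disjoint_left]
      intro T hTi hTj
      simp only [Finset.mem_filter, Finset.mem_univ, true_and, Finset.insert_subset_iff]
        at hTi hTj
      have hinj := Finset.card_image_iff.1 (show (T.image Prod.fst).card = T.card by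
        rw [hTi.1.1, hTi.1.2.1])
      exact hij (congrArg Prod.snd (hinj hTi.2.1 hTj.2.1 rfl))

/-- The number of edges of the coloured extension containing a properly coloured set `S`. -/
theorem card_filter_coloredExt {α : Type*} [Fintype α] [DecidableEq α] {k r : ℕ}
    (H : Multiset (Finset α)) (hb : ∀ E ∈ H, E.card ≤ r) (S : Finset (α × Fin k))
    (h₁ : Set.InjOn Prod.fst (S : Set (α × Fin k)))
    (h₂ : Set.InjOn Prod.snd (S : Set (α × Fin k))) :
    ((coloredExt k r H).filter fun T => S ⊆ T).card =
      (k - S.card).descFactorial (r - S.card) *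
        (H.filter fun E => S.image Prod.fst ⊆ E).card := by
  induction H using Multiset.induction_on with
  | empty => simp [coloredExt]
  | cons E H ih =>
    have hEr : E.card ≤ r := hb E (Multiset.mem_cons_self E H)
    specialize ih fun F hF => hb F (Multiset.mem_cons_of_mem hF)
    unfold coloredExt at ih ⊢
    rw [Multiset.cons_bind, Multiset.filter_add, Multiset.card_add, ih, Multiset.filter_nsmul,
      Multiset.card_nsmul, ← Finset.filter_val, Finset.filter_filter, Finset.card_val,
      Multiset.filter_cons, Multiset.card_add, mul_add]
    congr 1
    split_ifs with hSE
    · have hSc : S.card ≤ E.card := by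
        rw [← Finset.card_image_of_injOn h₁]
        exact Finset.card_le_card hSE
      rw [card_coloredCopies_superset E (E.card - S.card) S h₁ h₂ hSE (by omega),
        Multiset.card_singleton, mul_one,
        ← Nat.descFactorial_mul_descFactorial (n := k - S.card)
          (show E.card - S.card ≤ r - S.card by omega)]
      congr 2 <;> omega
    · rw [Finset.filter_eq_empty_iff.2, Finset.card_empty, Multiset.card_zero, mul_zero, mul_zero]
      rintro T - ⟨⟨rfl, -⟩, hST⟩
      exact hSE (Finset.image_subset_image hST)

/-- Every edge of the coloured extension is properly coloured. -/
theorem injOn_of_mem_coloredExt {α : Type*} [Fintype α] [DecidableEq α] {k r : ℕ}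
    {H : Multiset (Finset α)} {T : Finset (α × Fin k)} (hT : T ∈ coloredExt k r H) :
    Set.InjOn Prod.fst (T : Set (α × Fin k)) ∧ Set.InjOn Prod.snd (T : Set (α × Fin k)) := by
  obtain ⟨E, -, hTE⟩ := Multiset.mem_bind.1 hT
  obtain ⟨hfst, hc, hsnd⟩ := (Finset.mem_filter.1 (Multiset.mem_of_mem_nsmul hTE)).2
  exact ⟨Finset.card_image_iff.1 (by rw [hfst, hc]), Finset.card_image_iff.1 hsnd⟩

/-- The bound `(k)_s ≥ (k / e) ^ s`. -/
theorem pow_le_exp_pow_mul_descFactorial (k s : ℕ) (h : s ≤ k) :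
    (k : ℝ) ^ s ≤ Real.exp 1 ^ s * (k.descFactorial s : ℝ) := by
  induction k generalizing s with
  | zero =>
    obtain rfl : s = 0 := by omega
    simp
  | succ k ih =>
    rcases s with _ | s
    · simp
    have hs : s ≤ k := by omega
    have hstep : ((k : ℝ) + 1) ^ s ≤ Real.exp 1 * (k : ℝ) ^ s := by
      rcases Nat.eq_zero_or_pos k with rfl | hk
      · obtain rfl : s = 0 := by omega
        simp
      have hk' : (0 : ℝ) < k := by exact_mod_cast hk
      have hle : (k : ℝ) + 1 ≤ Real.exp (1 / k) * k := by
        have := mul_le_mul_of_nonneg_right (Real.add_one_le_exp (1 / (k : ℝ))) hk'.le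
        rwa [add_mul, one_div_mul_cancel hk'.ne', one_mul, add_comm] at this
      calc ((k : ℝ) + 1) ^ s ≤ (Real.exp (1 / k) * k) ^ s := by gcongr
        _ = Real.exp (s * (1 / k)) * (k : ℝ) ^ s := by rw [mul_pow, ← Real.exp_nat_mul]
        _ ≤ Real.exp 1 * (k : ℝ) ^ s := by
          gcongr
          rw [mul_one_div, div_le_one hk']
          exact_mod_cast hs
    rw [Nat.succ_descFactorial_succ]
    push_cast
    calc ((k : ℝ) + 1) ^ (s + 1) = (k + 1) * ((k : ℝ) + 1) ^ s := by ring
      _ ≤ (k + 1) * (Real.exp 1 * (Real.exp 1 ^ s * (k.descFactorial s : ℝ))) := by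
        gcongr
        exact hstep.trans (by gcongr; exact ih s hs)
      _ = Real.exp 1 ^ (s + 1) * (((k : ℝ) + 1) * (k.descFactorial s : ℝ)) := by ring

/-- If `H` is an `r`-bounded `κ`-spread multi-hypergraph and `k ≥ r`, then the colored
multi-hypergraph `H''` satisfies `|H''| = (k)_r |H|` (where `(k)_r` is the falling
factorial) and `H''` is `(kκ/e)`-spread. -/
theorem coloredExt_card_and_spread {α : Type*} [Fintype α] [DecidableEq α]
    (H : Multiset (Finset α)) (r k : ℕ) (κ : ℝ) (hκ : 0 < κ)
    (hb : ∀ E ∈ H, E.card ≤ r) (hs : Spread κ H) (hk : r ≤ k) :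
    Multiset.card (coloredExt k r H) = Nat.descFactorial k r * Multiset.card H ∧
      Spread ((k : ℝ) * κ / Real.exp 1) (coloredExt k r H) := by
  have hcard : Multiset.card (coloredExt k r H) = Nat.descFactorial k r * Multiset.card H := by
    simpa using card_filter_coloredExt H hb (∅ : Finset (α × Fin k)) (by simp) (by simp)
  refine ⟨hcard, fun S => ?_⟩
  by_cases hex : ∃ T ∈ coloredExt k r H, S ⊆ T
  swap
  · rw [Multiset.filter_eq_nil.2 fun T hT hST => hex ⟨T, hT, hST⟩, Multiset.card_zero,
      Nat.cast_zero]
    positivity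
  obtain ⟨T, hT, hST⟩ := hex
  obtain ⟨hT₁, hT₂⟩ := injOn_of_mem_coloredExt hT
  have h₁ : Set.InjOn Prod.fst (S : Set (α × Fin k)) := hT₁.mono (by exact_mod_cast hST)
  have h₂ : Set.InjOn Prod.snd (S : Set (α × Fin k)) := hT₂.mono (by exact_mod_cast hST)
  have hSr : S.card ≤ r := by
    obtain ⟨E, hE, hTE⟩ := Multiset.mem_bind.1 hT
    have hTc := (Finset.mem_filter.1 (Multiset.mem_of_mem_nsmul hTE)).2.2.1
    have := Finset.card_le_card hST
    have := hb E hE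
    omega
  have hspread := hs (S.image Prod.fst)
  rw [Finset.card_image_of_injOn h₁] at hspread
  have hbound := pow_le_exp_pow_mul_descFactorial k S.card (hSr.trans hk)
  have hpow : (0 : ℝ) < (k : ℝ) ^ S.card := by
    rcases S.card.eq_zero_or_pos with h0 | h0
    · simp [h0]
    · have : (0 : ℝ) < k := by exact_mod_cast (show 0 < k by omega)
      positivity
  have hratio : (1 : ℝ) ≤ (Real.exp 1 / k) ^ S.card * (k.descFactorial S.card : ℝ) := by
    rwa [div_pow, div_mul_eq_mul_div, one_le_div hpow]
  have hdesc : (k.descFactorial r : ℝ) =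
      ((k - S.card).descFactorial (r - S.card) : ℝ) * (k.descFactorial S.card : ℝ) := by
    exact_mod_cast (Nat.descFactorial_mul_descFactorial hSr).symm
  rw [card_filter_coloredExt H hb S h₁ h₂, hcard]
  push_cast
  rw [hdesc]
  calc ((k - S.card).descFactorial (r - S.card) : ℝ) *
        ((H.filter fun E => S.image Prod.fst ⊆ E).card : ℝ)
      ≤ ((k - S.card).descFactorial (r - S.card) : ℝ) * (κ⁻¹ ^ S.card * (H.card : ℝ)) := by
        gcongr
    _ ≤ ((k - S.card).descFactorial (r - S.card) : ℝ) * (κ⁻¹ ^ S.card * (H.card : ℝ)) *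
        ((Real.exp 1 / k) ^ S.card * (k.descFactorial S.card : ℝ)) :=
        le_mul_of_one_le_right (by positivity) hratio
    _ = ((k : ℝ) * κ / Real.exp 1)⁻¹ ^ S.card *
        (((k - S.card).descFactorial (r - S.card) : ℝ) * (k.descFactorial S.card : ℝ) *
          (H.card : ℝ)) := by
        rw [inv_div, mul_comm (k : ℝ) κ, show Real.exp 1 / (κ * k) = κ⁻¹ * (Real.exp 1 / k) by
          rw [div_mul_eq_div_div_swap, div_eq_inv_mul], mul_pow]
        ring
end

section
/- Let κ ≥ 6, let H be an r₁-uniform (1/κ; r₁,…,r_λ)-spread multi-hypergraph on a finite set X with r_λ = 1, let k ≥ r₁ be an integer, and let X' = X × [k]. Define the multi-hypergraph H'' on X' consisting, for each edge E = {x₁,…,x_{r₁}} of H (counted with multiplicity) and each choice of pairwise distinct colors i₁,…,i_{r₁} ∈ [k], of the set {(x₁,i₁),…,(x_{r₁},i_{r₁})}. Then |H''| = (k)_{r₁} · |H|, where (k)_{r₁} = k(k−1)⋯(k−r₁+1), and H'' is (3e/(kκ); r₁,…,r_λ)-spread, i.e. for every A ⊆ X' contained in at least one edge of H'' with r_i ≥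 |A| ≥ r_{i+1} for some 1 ≤ i < λ and every s ≥ r_{i+1}, the number of edges T ∈ H'' with |A ∩ T| = s is at most (3e/(kκ))^s |H''|. -/
open Finset
open scoped Classical

/-- A multi-hypergraph `H` is `(q; rs 1, …, rs lam)`-spread (Spiro spread): `H` is nonempty,
`rs 1`-bounded, and for every `A ⊆ V(H)` contained in at least one edge with
`rs i ≥ |A| ≥ rs (i+1)` for some `1 ≤ i < lam`, and every `j ≥ rs (i+1)`, the number of
edges `S ∈ H` with `|A ∩ S| = j` (with multiplicity) is at most `q^j |H|`. -/
def SpiroSpread {α : Type*} [DecidableEq α] (q : ℝ) (lam : ℕ) (rs : ℕ → ℕ)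
    (H : Multiset (Finset α)) : Prop :=
  H ≠ 0 ∧ (∀ E ∈ H, E.card ≤ rs 1) ∧
    ∀ A : Finset α, (∃ E ∈ H, A ⊆ E) →
      ∀ i : ℕ, 1 ≤ i → i < lam → rs (i + 1) ≤ A.card → A.card ≤ rs i →
        ∀ j : ℕ, rs (i + 1) ≤ j →
          ((H.filter fun S => (A ∩ S).card = j).card : ℝ) ≤ q ^ j * (H.card : ℝ)

/-- The multi-hypergraph `H''` on `X' = X × [k]`: for each edge `E = {x₁,…,x_{r₁}}` of `H`
(with multiplicity) and each choice of pairwise distinct colors `i₁,…,i_{r₁} ∈ [k]`,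
it contains the set `{(x₁,i₁),…,(x_{r₁},i_{r₁})}`. -/
noncomputable def coloredUnif {α : Type*} [Fintype α] [DecidableEq α] (k : ℕ)
    (H : Multiset (Finset α)) : Multiset (Finset (α × Fin k)) :=
  H.bind fun E =>
    (Finset.univ.filter fun S : Finset (α × Fin k) =>
      S.image Prod.fst = E ∧ S.card = E.card ∧ (S.image Prod.snd).card = S.card).val

theorem Nat.descFactorial_ge_div_exp_pow {k s : ℕ} (hsk : s ≤ k) :
    ((k : ℝ) / Real.exp 1) ^ s ≤ (k.descFactorial s : ℝ) := by
  rcases Nat.eq_zero_or_pos s with rfl | hs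
  · simp
  have hprod : (k : ℝ) ^ s * (s.factorial : ℝ) ≤ (k.descFactorial s : ℝ) * (s : ℝ) ^ s := by
    have : k ^ s * s.factorial ≤ k.descFactorial s * s ^ s := by
      rw [← Nat.descFactorial_self s, Nat.descFactorial_eq_prod_range,
        Nat.descFactorial_eq_prod_range]
      have h1 : k ^ s = ∏ _i ∈ Finset.range s, k := by simp
      have h2 : s ^ s = ∏ _i ∈ Finset.range s, s := by simp
      rw [h1, h2, ← Finset.prod_mul_distrib, ← Finset.prod_mul_distrib]
      refine Finset.prod_le_prod' fun i _ => ?_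
      rw [Nat.mul_sub, Nat.sub_mul, mul_comm k i]
      exact Nat.sub_le_sub_left (Nat.mul_le_mul_left i hsk) _
    exact_mod_cast this
  have hfac : (s : ℝ) ^ s ≤ Real.exp 1 ^ s * (s.factorial : ℝ) := by
    have h := Real.pow_div_factorial_le_exp (s : ℝ) (by positivity) s
    rw [div_le_iff₀ (by positivity)] at h
    rwa [← Real.exp_nat_mul, mul_one]
  rw [div_pow, div_le_iff₀ (by positivity)]
  have hf : (0 : ℝ) < s.factorial := by positivity
  refine le_of_mul_le_mul_right ?_ hf
  calc (k : ℝ) ^ s * s.factorial ≤ k.descFactorial s * (s : ℝ) ^ s := hprod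
    _ ≤ k.descFactorial s * (Real.exp 1 ^ s * s.factorial) := by gcongr
    _ = _ := by ring

theorem sum_choose_mul_pow_le_three_mul_pow {x : ℝ} (hx : 0 ≤ x) (hx6 : x ≤ 1 / 6) {s : ℕ}
    (hs : 1 ≤ s) (n : ℕ) :
    ∑ t ∈ Finset.range n, (t.choose s : ℝ) * x ^ t ≤ (3 * x) ^ s := by
  have hsum := hasSum_choose_mul_geometric_of_norm_lt_one s (r := x)
    (by rw [Real.norm_eq_abs, abs_lt]; constructor <;> linarith)
  have hshift : ∑ t ∈ Finset.range n, (t.choose s : ℝ) * x ^ t ≤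
      x ^ s * ∑ t ∈ Finset.range n, ((t + s).choose s : ℝ) * x ^ t := by
    calc ∑ t ∈ Finset.range n, (t.choose s : ℝ) * x ^ t
        ≤ ∑ t ∈ Finset.range (s + n), (t.choose s : ℝ) * x ^ t :=
          Finset.sum_le_sum_of_subset_of_nonneg (Finset.range_mono (by omega))
            fun _ _ _ => by positivity
      _ = x ^ s * ∑ t ∈ Finset.range n, ((t + s).choose s : ℝ) * x ^ t := by
          rw [Finset.sum_range_add, Finset.sum_eq_zero, zero_add, Finset.mul_sum]
          · refine Finset.sum_congr rfl fun t _ => ?_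
            rw [add_comm s t, pow_add]; ring
          · intro t ht
            rw [Nat.choose_eq_zero_of_lt (Finset.mem_range.1 ht)]; simp
  have hgeo : (1 : ℝ) / (1 - x) ^ (s + 1) ≤ 3 ^ s := by
    have hbase : ∀ m : ℕ, 1 ≤ m → (6 / 5 : ℝ) ^ (m + 1) ≤ 3 ^ m := by
      intro m hm
      induction m, hm using Nat.le_induction with
      | base => norm_num
      | succ m _ ih => rw [pow_succ, pow_succ 3 m]; gcongr; norm_num
    refine le_trans ?_ (hbase s hs)
    rw [← one_div_pow]
    have : 0 < 1 - x := by linarith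
    refine pow_le_pow_left₀ (by positivity) ?_ _
    rw [div_le_iff₀ this]; linarith
  calc _ ≤ _ := hshift
    _ ≤ x ^ s * 3 ^ s := by
        gcongr
        exact (sum_le_hasSum _ (fun _ _ => by positivity) hsum).trans hgeo
    _ = _ := by rw [mul_pow]; ring

theorem Multiset.sum_map_comp_eq_sum_card_filter {β : Type*} (H : Multiset β) (t : β → ℕ)
    (f : ℕ → ℕ) (n : ℕ) (h : ∀ E ∈ H, t E < n) :
    (H.map fun E => f (t E)).sum =
      ∑ j ∈ Finset.range n, Multiset.card (H.filter fun E => t E = j) * f j := by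
  induction H using Multiset.induction_on with
  | empty => simp
  | cons a H ih =>
    rw [Multiset.map_cons, Multiset.sum_cons,
      ih fun E hE => h E (Multiset.mem_cons_of_mem hE)]
    have hcard : ∀ j, Multiset.card ((a ::ₘ H).filter fun E => t E = j) =
        (if t a = j then 1 else 0) + Multiset.card (H.filter fun E => t E = j) := by
      intro j
      rw [Multiset.filter_cons, Multiset.card_add]
      split_ifs <;> simp
    simp only [hcard, add_mul, Finset.sum_add_distrib, ite_mul, one_mul, zero_mul]
    rw [Finset.sum_ite_eq, if_pos (Finset.mem_range.2 (h a (Multiset.mem_cons_self a H)))]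

/-- The graphs of injective maps from `E` to `C`. -/
noncomputable def injectiveGraphs {α β : Type*} [DecidableEq α] [DecidableEq β]
    (E : Finset α) (C : Finset β) : Finset (Finset (α × β)) :=
  (E ×ˢ C).powerset.filter fun S =>
    S.image Prod.fst = E ∧ S.card = E.card ∧ (S.image Prod.snd).card = S.card

theorem mem_injectiveGraphs {α β : Type*} [DecidableEq α] [DecidableEq β]
    {E : Finset α} {C : Finset β} {S : Finset (α × β)} :
    S ∈ injectiveGraphs E C ↔ S.image Prod.fst = E ∧ S.image Prod.snd ⊆ C ∧
      Set.InjOn Prod.fst (S : Set (α × β)) ∧ Set.InjOn Prod.snd (S : Set (α × β)) := by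
  rw [← Finset.card_image_iff, ← Finset.card_image_iff, injectiveGraphs, Finset.mem_filter,
    Finset.mem_powerset]
  constructor
  · rintro ⟨hsub, hE, hcard, hsnd⟩
    refine ⟨hE, ?_, by rw [hE, hcard], hsnd⟩
    intro c hc
    obtain ⟨p, hp, rfl⟩ := Finset.mem_image.1 hc
    exact (Finset.mem_product.1 (hsub hp)).2
  · rintro ⟨hE, hC, hfst, hsnd⟩
    refine ⟨fun p hp => Finset.mem_product.2 ⟨hE ▸ Finset.mem_image_of_mem _ hp,
      hC (Finset.mem_image_of_mem _ hp)⟩, hE, by rw [← hfst, hE], hsnd⟩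

theorem card_injectiveGraphs {α β : Type*} [DecidableEq α] [DecidableEq β]
    (E : Finset α) (C : Finset β) :
    (injectiveGraphs E C).card = C.card.descFactorial E.card := by
  have hemb : Fintype.card (E ↪ C) = C.card.descFactorial E.card := by
    rw [Fintype.card_embedding_eq]; simp
  rw [← hemb, ← Finset.card_univ]
  symm
  refine Finset.card_bij
    (fun f _ => Finset.univ.image fun e : E => ((e : α), ((f e : C) : β))) ?_ ?_ ?_
  · intro f _
    rw [mem_injectiveGraphs]
    refine ⟨?_, ?_, ?_, ?_⟩
    · ext a; simp
    · intro c; simp only [Finset.mem_image]; rintro ⟨p, ⟨e, -, rfl⟩, rfl⟩; exact (f e).2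
    · intro p hp q hq h
      simp only [Finset.coe_image, Set.mem_image] at hp hq
      obtain ⟨e, -, rfl⟩ := hp
      obtain ⟨e', -, rfl⟩ := hq
      obtain rfl : e = e' := Subtype.ext h
      rfl
    · intro p hp q hq h
      simp only [Finset.coe_image, Set.mem_image] at hp hq
      obtain ⟨e, -, rfl⟩ := hp
      obtain ⟨e', -, rfl⟩ := hq
      obtain rfl : e = e' := f.injective (Subtype.ext h)
      rfl
  · intro f _ g _ h
    ext e
    have hmem : ((e : α), ((f e : C) : β)) ∈
        Finset.univ.image fun e : E => ((e : α), ((g e : C) : β)) :=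
      h ▸ Finset.mem_image_of_mem _ (Finset.mem_univ e)
    obtain ⟨e', -, he'⟩ := Finset.mem_image.1 hmem
    obtain ⟨h1, h2⟩ := Prod.mk.inj he'
    obtain rfl : e' = e := Subtype.ext h1
    exact h2.symm
  · intro S hS
    obtain ⟨hE, hC, hfst, hsnd⟩ := mem_injectiveGraphs.1 hS
    have hex : ∀ e : E, ∃ c : C, ((e : α), (c : β)) ∈ S := by
      rintro ⟨e, he⟩
      rw [← hE] at he
      obtain ⟨⟨a, c⟩, hp, rfl⟩ := Finset.mem_image.1 he
      exact ⟨⟨c, hC (Finset.mem_image_of_mem Prod.snd hp)⟩, hp⟩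
    choose f hf using hex
    refine ⟨⟨f, fun e e' h => ?_⟩, Finset.mem_univ _, ?_⟩
    · exact Subtype.ext (Prod.mk.inj (hsnd (hf e) (hf e') (by simp [h]))).1
    · ext ⟨a, c⟩
      simp only [Finset.mem_image, Finset.mem_univ, true_and]
      constructor
      · rintro ⟨e, he⟩
        exact he ▸ hf e
      · intro hac
        have ha : a ∈ E := hE ▸ Finset.mem_image_of_mem Prod.fst hac
        exact ⟨⟨a, ha⟩, hfst (hf ⟨a, ha⟩) hac rfl⟩

theorem card_injectiveGraphs_superset_le {α β : Type*} [DecidableEq α] [DecidableEq β]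
    (E : Finset α) (C : Finset β) (P : Finset (α × β)) :
    ((injectiveGraphs E C).filter fun S => P ⊆ S).card ≤
      (C.card - P.card).descFactorial (E.card - P.card) := by
  rcases Finset.eq_empty_or_nonempty ((injectiveGraphs E C).filter fun S => P ⊆ S)
    with h | ⟨S₀, hS₀⟩
  · simp [h]
  rw [Finset.mem_filter, mem_injectiveGraphs] at hS₀
  obtain ⟨⟨hE₀, hC₀, hfst₀, hsnd₀⟩, hP₀⟩ := hS₀
  have hPE : P.image Prod.fst ⊆ E := hE₀ ▸ Finset.image_subset_image hP₀
  have hPC : P.image Prod.snd ⊆ C := (Finset.image_subset_image hP₀).trans hC₀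
  have hcE : (P.image Prod.fst).card = P.card :=
    Finset.card_image_of_injOn (hfst₀.mono (Finset.coe_subset.2 hP₀))
  have hcC : (P.image Prod.snd).card = P.card :=
    Finset.card_image_of_injOn (hsnd₀.mono (Finset.coe_subset.2 hP₀))
  rw [← hcE, ← Finset.card_sdiff_of_subset hPE, hcE, ← hcC, ← Finset.card_sdiff_of_subset hPC,
    ← card_injectiveGraphs]
  refine Finset.card_le_card_of_injOn (fun S => S \ P) ?_ ?_
  · intro S hS
    rw [Finset.mem_coe, Finset.mem_filter, mem_injectiveGraphs] at hS
    obtain ⟨⟨hE, hC, hfst, hsnd⟩, hP⟩ := hS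
    have hsub : ((S \ P : Finset (α × β)) : Set (α × β)) ⊆ S :=
      Finset.coe_subset.2 Finset.sdiff_subset
    rw [Finset.mem_coe, mem_injectiveGraphs]
    refine ⟨?_, ?_, hfst.mono hsub, hsnd.mono hsub⟩
    · rw [← hE, Finset.image_sdiff_of_injOn hfst hP]
    · rw [Finset.image_sdiff_of_injOn hsnd hP]
      exact Finset.sdiff_subset_sdiff hC subset_rfl
  · intro S hS T hT h
    rw [Finset.mem_coe, Finset.mem_filter] at hS hT
    rw [← Finset.sdiff_union_of_subset hS.2, ← Finset.sdiff_union_of_subset hT.2]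
    exact congrArg (· ∪ P) h

theorem card_injectiveGraphs_inter_eq_le {α β : Type*} [DecidableEq α] [DecidableEq β]
    (E : Finset α) (C : Finset β) (A : Finset (α × β))
    (hA : Set.InjOn Prod.fst (A : Set (α × β))) (s : ℕ) :
    ((injectiveGraphs E C).filter fun S => (A ∩ S).card = s).card ≤
      (A.image Prod.fst ∩ E).card.choose s * (C.card - s).descFactorial (E.card - s) := by
  set A' := A.filter fun p => p.1 ∈ E
  have hcard : (A.image Prod.fst ∩ E).card = A'.card := by
    rw [← Finset.card_image_of_injOn
      (hA.mono (Finset.coe_subset.2 (Finset.filter_subset (fun p => p.1 ∈ E) A)))]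
    congr 1
    ext a
    simp only [Finset.mem_inter, Finset.mem_image, Finset.mem_filter]
    constructor
    · rintro ⟨⟨p, hp, rfl⟩, ha⟩; exact ⟨p, ⟨hp, ha⟩, rfl⟩
    · rintro ⟨p, ⟨hp, ha⟩, rfl⟩; exact ⟨⟨p, hp, rfl⟩, ha⟩
  rw [hcard, ← Finset.card_powersetCard]
  have hsub : ((injectiveGraphs E C).filter fun S => (A ∩ S).card = s) ⊆
      (A'.powersetCard s).biUnion fun P => (injectiveGraphs E C).filter fun S => P ⊆ S := by
    intro S hS
    rw [Finset.mem_filter] at hS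
    have hE := (mem_injectiveGraphs.1 hS.1).1
    refine Finset.mem_biUnion.2 ⟨A ∩ S, Finset.mem_powersetCard.2 ⟨fun p hp => ?_, hS.2⟩,
      Finset.mem_filter.2 ⟨hS.1, Finset.inter_subset_right⟩⟩
    rw [Finset.mem_inter] at hp
    exact Finset.mem_filter.2 ⟨hp.1, hE ▸ Finset.mem_image_of_mem Prod.fst hp.2⟩
  refine (Finset.card_le_card hsub).trans (Finset.card_biUnion_le_card_mul _ _ _ fun P hP => ?_)
  rw [← (Finset.mem_powersetCard.1 hP).2]
  exact card_injectiveGraphs_superset_le E C P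

theorem coloredUnif_eq_bind_injectiveGraphs {α : Type*} [Fintype α] [DecidableEq α] (k : ℕ)
    (H : Multiset (Finset α)) :
    coloredUnif k H = H.bind fun E => (injectiveGraphs E (Finset.univ : Finset (Fin k))).val := by
  refine Multiset.bind_congr fun E _ => congrArg Finset.val ?_
  ext S
  simp only [injectiveGraphs, Finset.mem_filter, Finset.mem_univ, true_and, Finset.mem_powerset]
  refine ⟨fun h => ⟨fun p hp => ?_, h⟩, fun h => h.2⟩
  exact Finset.mem_product.2 ⟨h.1 ▸ Finset.mem_image_of_mem Prod.fst hp, Finset.mem_univ _⟩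

theorem mem_coloredUnif {α : Type*} [Fintype α] [DecidableEq α] {k : ℕ}
    {H : Multiset (Finset α)} {S : Finset (α × Fin k)} :
    S ∈ coloredUnif k H ↔ S.image Prod.fst ∈ H ∧
      Set.InjOn Prod.fst (S : Set (α × Fin k)) ∧ Set.InjOn Prod.snd (S : Set (α × Fin k)) := by
  rw [coloredUnif_eq_bind_injectiveGraphs, Multiset.mem_bind]
  simp only [Finset.mem_val, mem_injectiveGraphs, Finset.subset_univ, true_and]
  constructor
  · rintro ⟨E, hE, rfl, h⟩; exact ⟨hE, h⟩
  · rintro ⟨hE, h⟩; exact ⟨_, hE, rfl, h⟩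

theorem card_coloredUnif {α : Type*} [Fintype α] [DecidableEq α] (k r : ℕ)
    (H : Multiset (Finset α)) (hunif : ∀ E ∈ H, E.card = r) :
    Multiset.card (coloredUnif k H) = k.descFactorial r * Multiset.card H := by
  rw [coloredUnif_eq_bind_injectiveGraphs, Multiset.card_bind,
    Multiset.map_congr rfl (g := fun _ => k.descFactorial r)]
  · simp [mul_comm]
  · intro E hE
    simp only [Function.comp_apply, Finset.card_val, card_injectiveGraphs, hunif E hE,
      Finset.card_univ, Fintype.card_fin]

theorem card_coloredUnif_inter_eq_le {α : Type*} [Fintype α] [DecidableEq α] (k r : ℕ)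
    (H : Multiset (Finset α)) (hunif : ∀ E ∈ H, E.card = r) (A : Finset (α × Fin k))
    (hA : Set.InjOn Prod.fst (A : Set (α × Fin k))) (s : ℕ) :
    Multiset.card ((coloredUnif k H).filter fun S => (A ∩ S).card = s) ≤
      ∑ t ∈ Finset.range (r + 1),
        Multiset.card (H.filter fun E => (A.image Prod.fst ∩ E).card = t) *
          (t.choose s * (k - s).descFactorial (r - s)) := by
  rw [← Multiset.sum_map_comp_eq_sum_card_filter H (fun E => (A.image Prod.fst ∩ E).card)
      (fun t => t.choose s * (k - s).descFactorial (r - s)) (r + 1) fun E hE =>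
        Nat.lt_succ_of_le ((Finset.card_le_card Finset.inter_subset_right).trans
          (hunif E hE).le),
    coloredUnif_eq_bind_injectiveGraphs, Multiset.filter_bind, Multiset.card_bind]
  refine Multiset.sum_map_le_sum_map _ _ fun E hE => ?_
  have h := card_injectiveGraphs_inter_eq_le E (Finset.univ : Finset (Fin k)) A hA s
  rw [Finset.card_univ, Fintype.card_fin, hunif E hE] at h
  exact h

/-- If `κ ≥ 6` and `H` is an `r₁`-uniform `(1/κ; r₁,…,r_λ)`-spread multi-hypergraph with
`r_λ = 1`, and `k ≥ r₁`, then the colored multi-hypergraph `H''` satisfies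
`|H''| = (k)_{r₁} |H|` and `H''` is `(3e/(kκ); r₁,…,r_λ)`-spread. -/
theorem coloredUnif_card_and_spiroSpread {α : Type*} [Fintype α] [DecidableEq α]
    (H : Multiset (Finset α)) (lam k : ℕ) (rs : ℕ → ℕ) (κ : ℝ)
    (hlam : 1 ≤ lam) (hdec : ∀ i, 1 ≤ i → i < lam → rs (i + 1) < rs i) (hlast : rs lam = 1)
    (hκ : 6 ≤ κ) (hunif : ∀ E ∈ H, E.card = rs 1) (hs : SpiroSpread (1 / κ) lam rs H)
    (hk : rs 1 ≤ k) :
    Multiset.card (coloredUnif k H) = Nat.descFactorial k (rs 1) * Multiset.card H ∧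
      SpiroSpread (3 * Real.exp 1 / ((k : ℝ) * κ)) lam rs (coloredUnif k H) := by
  have hcard := card_coloredUnif k (rs 1) H hunif
  refine ⟨hcard, ?_, ?_, ?_⟩
  · rw [← Multiset.card_pos, hcard]
    exact Nat.mul_pos (Nat.descFactorial_pos.2 hk) (Multiset.card_pos.2 hs.1)
  · intro S hS
    obtain ⟨hE, hfst, -⟩ := mem_coloredUnif.1 hS
    rw [← Finset.card_image_of_injOn hfst]
    exact (hunif _ hE).le
  · rintro A ⟨S₀, hS₀, hAS₀⟩ i hi hil hiA hAi s his
    obtain ⟨hE₀, hfst₀, -⟩ := mem_coloredUnif.1 hS₀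
    have hA : Set.InjOn Prod.fst (A : Set (α × Fin k)) := hfst₀.mono (Finset.coe_subset.2 hAS₀)
    have hAcard : (A.image Prod.fst).card = A.card := Finset.card_image_of_injOn hA
    have hpos : 1 ≤ rs (i + 1) := by
      have hmono : ∀ d j, 1 ≤ j → j + d = lam → 1 ≤ rs j := by
        intro d
        induction d with
        | zero => rintro j - rfl; exact hlast.ge
        | succ d ih =>
          intro j hj hjd
          exact (ih (j + 1) (by omega) (by omega)).trans (hdec j hj (by omega)).le
      exact hmono (lam - (i + 1)) (i + 1) (by omega) (by omega)
    have hκ0 : 0 < κ := by linarith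
    have hk0 : 0 < k := by
      have : 1 ≤ A.card := hpos.trans hiA
      obtain ⟨p, -⟩ := Finset.card_pos.1 this
      exact p.2.pos
    rcases lt_or_ge (rs 1) s with hsr | hsr
    · have hzero : ((coloredUnif k H).filter fun S => (A ∩ S).card = s) = 0 := by
        refine Multiset.filter_eq_nil.2 fun S _ hS => ?_
        have h1 : (A ∩ S).card ≤ A.card := Finset.card_le_card Finset.inter_subset_left
        have h2 : A.card ≤ rs 1 := by
          rw [← hAcard, ← hunif _ hE₀]
          exact Finset.card_le_card (Finset.image_subset_image hAS₀)
        omega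
      rw [hzero, Multiset.card_zero, Nat.cast_zero]
      positivity
    set D := (k - s).descFactorial (rs 1 - s)
    have hDk : D * k.descFactorial s = k.descFactorial (rs 1) :=
      Nat.descFactorial_mul_descFactorial hsr
    have hx6 : 1 / κ ≤ 1 / 6 := one_div_le_one_div_of_le (by norm_num) hκ
    calc (Multiset.card ((coloredUnif k H).filter fun S => (A ∩ S).card = s) : ℝ)
        ≤ ∑ t ∈ Finset.range (rs 1 + 1),
            (Multiset.card (H.filter fun E => (A.image Prod.fst ∩ E).card = t) : ℝ) *
              ((t.choose s : ℝ) * D) := by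
          exact_mod_cast card_coloredUnif_inter_eq_le k (rs 1) H hunif A hA s
      _ ≤ ∑ t ∈ Finset.range (rs 1 + 1),
            ((1 / κ) ^ t * Multiset.card H) * ((t.choose s : ℝ) * D) := by
          refine Finset.sum_le_sum fun t _ => ?_
          rcases lt_or_ge t s with hts | hts
          · simp [Nat.choose_eq_zero_of_lt hts]
          · refine mul_le_mul_of_nonneg_right ?_ (by positivity)
            exact hs.2.2 (A.image Prod.fst) ⟨_, hE₀, Finset.image_subset_image hAS₀⟩ i hi hil
              (hAcard ▸ hiA) (hAcard ▸ hAi) t (his.trans hts)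
      _ = (∑ t ∈ Finset.range (rs 1 + 1), (t.choose s : ℝ) * (1 / κ) ^ t) *
            (D * Multiset.card H) := by
          rw [Finset.sum_mul]
          exact Finset.sum_congr rfl fun t _ => by ring
      _ ≤ (3 * (1 / κ)) ^ s * (D * Multiset.card H) := by
          gcongr
          exact sum_choose_mul_pow_le_three_mul_pow (by positivity) hx6 (hpos.trans his) _
      _ = (3 * Real.exp 1 / (k * κ)) ^ s *
            ((D * (k / Real.exp 1) ^ s) * Multiset.card H) := by
          have hsplit : 3 * (1 / κ) = 3 * Real.exp 1 / (k * κ) * (k / Real.exp 1) := by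
            field_simp
          rw [hsplit, mul_pow]; ring
      _ ≤ (3 * Real.exp 1 / (k * κ)) ^ s * ((D * k.descFactorial s) * Multiset.card H) := by
          gcongr
          exact Nat.descFactorial_ge_div_exp_pow (hsr.trans hk)
      _ = (3 * Real.exp 1 / (k * κ)) ^ s * Multiset.card (coloredUnif k H) := by
          rw [hcard, ← hDk]; push_cast; ring
end

section
/- For all integers k, ℓ with 2 ≤ ℓ < k and all ε > 0, there exist K' = K'(k, ε) and n₀ such that the following holds for all n ≥ n₀ with (k−ℓ) | n. Let p = K' n^{ℓ−k}, let G^{(k)}(n,p) be the binomial random k-uniform hypergraph on n vertices in which each k-set is an edge independently with probability p, and color the edges of G^{(k)}(n,p) independently and uniformly at random with q ≥ n/(k−ℓ) colors. Then with probability at least 1 − ε, the resulting colored hypergraph contains a rainbow Hamilton ℓ-cycle, i.e. a Hamilton ℓ-cycle in which no two edges receive the same color. -/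
open Finset
open scoped Classical

/-- The `i`-th edge of the Hamilton `ℓ`-cycle determined by the cyclic vertex ordering `σ`
of the `n` vertices: `{v_{i(k-ℓ)+1}, …, v_{i(k-ℓ)+k}}`, indices modulo `n`. -/
noncomputable def cycEdge (n k l : ℕ) [NeZero n] (σ : Equiv.Perm (ZMod n)) (i : ℕ) :
    Finset (ZMod n) :=
  (Finset.range k).image fun j => σ (((i * (k - l) + j : ℕ) : ZMod n))

/-- The probability that the random `k`-uniform hypergraph `G^(k)(n,p)` on vertex set
`ZMod n` (each `k`-set an edge independently with probability `p`), whose edges are colored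
independently and uniformly at random with `qc` colors, contains a rainbow Hamilton
`ℓ`-cycle: a cyclic ordering `σ` of the vertices all of whose `n/(k-ℓ)` edges are present
and receive pairwise distinct colors. -/
noncomputable def rainbowHamCycleProb (n k l qc : ℕ) [NeZero n] (p : ℝ) : ℝ :=
  ∑ E ∈ (Finset.univ.filter fun S : Finset (ZMod n) => S.card = k).powerset,
    ∑ c : Finset (ZMod n) → Fin qc,
      p ^ E.card *
        (1 - p) ^ ((Finset.univ.filter fun S : Finset (ZMod n) => S.card = k).card - E.card) *
        ((qc : ℝ) ^ Fintype.card (Finset (ZMod n)))⁻¹ *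
        (if ∃ σ : Equiv.Perm (ZMod n),
            (∀ i < n / (k - l), cycEdge n k l σ i ∈ E) ∧
            (∀ i < n / (k - l), ∀ j < n / (k - l),
              c (cycEdge n k l σ i) = c (cycEdge n k l σ j) →
                cycEdge n k l σ i = cycEdge n k l σ j)
          then 1 else 0)

theorem sum_powerset_superset_weight {α : Type*} (U A : Finset α) (hA : A ⊆ U) (p : ℝ) :
    ∑ E ∈ U.powerset, (if A ⊆ E then p ^ #E * (1 - p) ^ (#U - #E) else 0) = p ^ #A := by
  rw [← Finset.sum_filter]
  have hset : U.powerset.filter (fun E => A ⊆ E) = Finset.Icc A U := by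
    ext E; simp [and_comm]
  rw [hset, Finset.Icc_eq_image_powerset hA, Finset.sum_image]
  · have key : ∀ E ∈ (U \ A).powerset, p ^ #(A ∪ E) * (1 - p) ^ (#U - #(A ∪ E)) =
        p ^ #A * (p ^ #E * (1 - p) ^ (#(U \ A) - #E)) := by
      intro E hE
      have hd : Disjoint A E :=
        Finset.disjoint_of_subset_right (Finset.mem_powerset.1 hE) Finset.disjoint_sdiff
      rw [Finset.card_union_of_disjoint hd, Finset.card_sdiff_of_subset hA, pow_add,
        Nat.sub_sub, mul_assoc]
    rw [Finset.sum_congr rfl key, ← Finset.mul_sum, Finset.sum_pow_mul_eq_add_pow]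
    simp
  · intro E hE F hF h
    have hE' := Finset.disjoint_of_subset_right (Finset.mem_powerset.1 hE)
      (Finset.disjoint_sdiff (s := A) (t := U))
    have hF' := Finset.disjoint_of_subset_right (Finset.mem_powerset.1 hF)
      (Finset.disjoint_sdiff (s := A) (t := U))
    have h' : A ∪ E = A ∪ F := h
    rw [← Finset.union_sdiff_cancel_left hE', h', Finset.union_sdiff_cancel_left hF']

/-- The number of `q`-colorings of `α` that are injective on `A` and on `B`. -/
noncomputable def rainbowCount {α : Type*} [Fintype α] (q : ℕ) (A B : Finset α) : ℕ :=
  #(univ.filter fun c : α → Fin q => Set.InjOn c A ∧ Set.InjOn c B)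

theorem injOn_update_of_notMem {α β : Type*} {c : α → β} {x : α} {v : β} {A : Finset α}
    (hx : x ∉ A) : Set.InjOn (Function.update c x v) A ↔ Set.InjOn c A := by
  refine Set.EqOn.injOn_iff fun y hy => ?_
  have : y ≠ x := fun h => hx (h ▸ hy)
  simp [this]

theorem rainbowCount_insert {α : Type*} [Fintype α] (q : ℕ) {A B : Finset α} {x : α}
    (hA : x ∉ A) (hB : x ∉ B) :
    rainbowCount q A (insert x B) * q = rainbowCount q A B * (q - #B) := by
  have h1 : rainbowCount q A (insert x B) * q =
      #((univ.filter fun c : α → Fin q => Set.InjOn c A ∧ Set.InjOn c (insert x B : Finset α)) ×ˢ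
        (univ : Finset (Fin q))) := by
    simp [rainbowCount]
  have h2 : rainbowCount q A B * (q - #B) =
      #((univ.filter fun c : α → Fin q => Set.InjOn c A ∧ Set.InjOn c B).sigma
        fun c => univ \ B.image c) := by
    rw [Finset.card_sigma, rainbowCount, ← smul_eq_mul, ← Finset.sum_const]
    refine Finset.sum_congr rfl fun c hc => ?_
    simp only [mem_filter, mem_univ, true_and] at hc
    rw [Finset.card_sdiff_of_subset (Finset.subset_univ _), Finset.card_image_of_injOn hc.2]
    simp
  rw [h1, h2]
  refine Finset.card_bij' (fun c _ => ⟨Function.update c.1 x c.2, c.1 x⟩)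
    (fun c _ => (Function.update c.1 x c.2, c.1 x)) ?_ ?_ ?_ ?_
  · rintro ⟨c, u⟩ h
    simp only [mem_product, mem_filter, mem_univ, true_and, and_true, coe_insert] at h
    rw [Set.injOn_insert (by simpa using hB)] at h
    simp only [mem_sigma, mem_filter, mem_univ, true_and, mem_sdiff, mem_image,
      injOn_update_of_notMem hA, injOn_update_of_notMem hB]
    refine ⟨⟨h.1, h.2.1⟩, ?_⟩
    rintro ⟨y, hy, hyx⟩
    have : y ≠ x := fun h => hB (h ▸ hy)
    rw [Function.update_of_ne this] at hyx
    exact h.2.2 ⟨y, hy, hyx⟩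
  · rintro ⟨c, u⟩ h
    simp only [mem_sigma, mem_filter, mem_univ, true_and, mem_sdiff, mem_image] at h
    simp only [mem_product, mem_filter, mem_univ, true_and, and_true, coe_insert]
    rw [Set.injOn_insert (by simpa using hB), injOn_update_of_notMem hA,
      injOn_update_of_notMem hB]
    refine ⟨h.1.1, h.1.2, ?_⟩
    rintro ⟨y, hy, hyx⟩
    have hne : y ≠ x := fun h => hB (h ▸ hy)
    rw [Function.update_of_ne hne, Function.update_self] at hyx
    exact h.2 ⟨y, hy, hyx⟩
  · rintro ⟨c, u⟩ h
    simp
  · rintro ⟨c, u⟩ h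
    simp

theorem rainbowCount_union {α : Type*} [Fintype α] {q : ℕ} (hq : 0 < q) (A B C : Finset α)
    (hAC : Disjoint A C) (hBC : Disjoint B C) (hc : #B + #C ≤ q) :
    (rainbowCount q A (B ∪ C) : ℝ) =
      rainbowCount q A B * ∏ i ∈ Finset.Ico #B (#B + #C), (1 - (i : ℝ) / q) := by
  have hq' : (q : ℝ) ≠ 0 := by positivity
  induction C using Finset.induction_on with
  | empty => simp
  | insert x C hx ih =>
    rw [Finset.disjoint_insert_right] at hAC hBC
    rw [Finset.card_insert_of_notMem hx] at hc ⊢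
    have hx' : x ∉ B ∪ C := by simp [hBC.1, hx]
    have h := rainbowCount_insert q hAC.1 hx'
    have h' : (rainbowCount q A (insert x (B ∪ C)) : ℝ) * q =
        rainbowCount q A (B ∪ C) * ((q : ℝ) - (#B + #C : ℕ)) := by
      rw [← Nat.cast_sub (by omega)]
      rw [Finset.card_union_of_disjoint hBC.2] at h
      exact_mod_cast h
    rw [Finset.union_insert, ← add_assoc, Finset.prod_Ico_succ_top (by omega), ← mul_assoc,
      ← ih hAC.2 hBC.2 (by omega)]
    field_simp
    exact h'

theorem rainbowCount_empty_left {α : Type*} [Fintype α] {q : ℕ} (hq : 0 < q) (A : Finset α)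
    (hc : #A ≤ q) :
    (rainbowCount q ∅ A : ℝ) =
      (q : ℝ) ^ Fintype.card α * ∏ i ∈ Finset.range #A, (1 - (i : ℝ) / q) := by
  have h := rainbowCount_union hq ∅ ∅ A (by simp) (by simp) (by simpa using hc)
  have h0 : (rainbowCount q (∅ : Finset α) ∅ : ℝ) = (q : ℝ) ^ Fintype.card α := by
    simp [rainbowCount]
  simpa [h0] using h

theorem pow_mul_exp_neg_le_descFactorial {q s : ℕ} (h : s ≤ q) :
    (q : ℝ) ^ s * Real.exp (-(s : ℝ)) ≤ q.descFactorial s := by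
  induction s generalizing q with
  | zero => simp
  | succ s ih =>
    obtain ⟨q, rfl⟩ : ∃ q', q = q' + 1 := ⟨q - 1, by omega⟩
    have hs : s ≤ q := by omega
    have key : ((q : ℝ) + 1) ^ s ≤ Real.exp 1 * (q : ℝ) ^ s := by
      rcases Nat.eq_zero_or_pos s with rfl | hs0
      · simp
      have hq : (0 : ℝ) < q := by exact_mod_cast (by omega : 0 < q)
      have h1 : (q : ℝ) + 1 ≤ q * Real.exp (1 / q) := by
        have := mul_le_mul_of_nonneg_left (Real.add_one_le_exp (1 / (q : ℝ))) hq.le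
        have h2 : (q : ℝ) * (1 / q + 1) = q + 1 := by field_simp; ring
        linarith
      calc ((q : ℝ) + 1) ^ s ≤ (q * Real.exp (1 / q)) ^ s := by gcongr
        _ = Real.exp (s * (1 / q)) * (q : ℝ) ^ s := by
          rw [mul_pow, ← Real.exp_nat_mul]; ring
        _ ≤ Real.exp 1 * (q : ℝ) ^ s := by
          gcongr
          rw [mul_one_div, div_le_one hq]
          exact_mod_cast hs
    rw [Nat.succ_descFactorial_succ]
    push_cast
    have he : Real.exp (-((s : ℝ) + 1)) = Real.exp (-(s : ℝ)) * (Real.exp 1)⁻¹ := by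
      rw [← Real.exp_neg, ← Real.exp_add]; ring_nf
    calc ((q : ℝ) + 1) ^ (s + 1) * Real.exp (-((s : ℝ) + 1))
        = (q + 1) * ((q + 1) ^ s * (Real.exp 1)⁻¹) * Real.exp (-(s : ℝ)) := by rw [he]; ring
      _ ≤ (q + 1) * (Real.exp 1 * (q : ℝ) ^ s * (Real.exp 1)⁻¹) * Real.exp (-(s : ℝ)) := by
        gcongr
      _ = (q + 1) * ((q : ℝ) ^ s * Real.exp (-(s : ℝ))) := by
        field_simp
      _ ≤ (q + 1) * (q.descFactorial s : ℝ) := by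
        gcongr
        exact ih hs

theorem exp_neg_le_prod_one_sub_div {q s : ℕ} (hq : 0 < q) (h : s ≤ q) :
    Real.exp (-(s : ℝ)) ≤ ∏ i ∈ Finset.range s, (1 - (i : ℝ) / q) := by
  have hq' : (0 : ℝ) < q := by exact_mod_cast hq
  have h1 : (q.descFactorial s : ℝ) =
      (q : ℝ) ^ s * ∏ i ∈ Finset.range s, (1 - (i : ℝ) / q) := by
    have h2 : (q : ℝ) ^ s = ∏ _i ∈ Finset.range s, (q : ℝ) := by simp
    rw [Nat.descFactorial_eq_prod_range, Nat.cast_prod, h2, ← Finset.prod_mul_distrib]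
    refine Finset.prod_congr rfl fun i hi => ?_
    rw [Nat.cast_sub (by have := Finset.mem_range.1 hi; omega)]
    field_simp
  have := pow_mul_exp_neg_le_descFactorial h
  rw [h1] at this
  exact le_of_mul_le_mul_left this (by positivity)

theorem factorial_sub_div_factorial_le {n v : ℕ} (hn : 0 < n) (h : v ≤ n) :
    ((n - v).factorial : ℝ) / n.factorial ≤ (Real.exp 1 / n) ^ v := by
  have hn' : (0 : ℝ) < n := by exact_mod_cast hn
  have h1 : ((n - v).factorial : ℝ) * n.descFactorial v = n.factorial := by
    exact_mod_cast Nat.factorial_mul_descFactorial h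
  have h2 := pow_mul_exp_neg_le_descFactorial h
  rw [div_le_iff₀ (by positivity), ← h1]
  have h3 : (Real.exp 1 / n) ^ v * ((n : ℝ) ^ v * Real.exp (-(v : ℝ))) = 1 := by
    rw [← mul_assoc, ← mul_pow, div_mul_cancel₀ _ hn'.ne', ← Real.exp_nat_mul, ← Real.exp_add]
    simp
  calc ((n - v).factorial : ℝ) = (n - v).factorial *
        ((Real.exp 1 / n) ^ v * ((n : ℝ) ^ v * Real.exp (-(v : ℝ)))) := by rw [h3, mul_one]
    _ ≤ (n - v).factorial * ((Real.exp 1 / n) ^ v * n.descFactorial v) := by gcongr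
    _ = _ := by ring

/-- Colorings injective on two sets of size `h` are nearly independent of each other, up to a
factor exponential in the size of the intersection. -/
theorem rainbowCount_le {α : Type*} [Fintype α] {q h : ℕ} (hq : 0 < q) (hh : h ≤ q)
    {A B : Finset α} (hA : #A = h) (hB : #B = h) :
    (rainbowCount q A B : ℝ) ≤ (q : ℝ) ^ Fintype.card α * Real.exp #(A ∩ B) *
      (∏ i ∈ Finset.range h, (1 - (i : ℝ) / q)) ^ 2 := by
  have hq' : (0 : ℝ) < q := by exact_mod_cast hq
  have hs : #(A ∩ B) ≤ h := hA ▸ Finset.card_le_card Finset.inter_subset_left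
  have hBs : #(A ∩ B) + #(B \ A) = h := by
    rw [add_comm, Finset.inter_comm, Finset.card_sdiff_add_card_inter, hB]
  have h1 := rainbowCount_union hq A (A ∩ B) (B \ A) Finset.disjoint_sdiff
    (Finset.disjoint_of_subset_left Finset.inter_subset_left Finset.disjoint_sdiff) (by omega)
  have hun : A ∩ B ∪ B \ A = B := by
    ext x; simp only [mem_union, mem_inter, mem_sdiff]; tauto
  have h2 : rainbowCount q A (A ∩ B) = rainbowCount q ∅ A := by
    unfold rainbowCount
    congr 1
    ext c
    simp only [mem_filter, mem_univ, true_and, coe_empty, Set.injOn_empty]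
    exact ⟨fun h => h.1, fun h => ⟨h, h.mono (by simp)⟩⟩
  rw [hun, h2, rainbowCount_empty_left hq A (by omega), hA, hBs] at h1
  have hpos : ∀ i ∈ Finset.range h, (0 : ℝ) ≤ 1 - (i : ℝ) / q := fun i hi => by
    have : (i : ℝ) ≤ q := by exact_mod_cast (by have := Finset.mem_range.1 hi; omega)
    rw [sub_nonneg, div_le_one hq']; exact this
  have hI : (0 : ℝ) ≤ ∏ i ∈ Finset.Ico #(A ∩ B) h, (1 - (i : ℝ) / q) :=
    Finset.prod_nonneg fun i hi => hpos i (Finset.mem_range.2 (Finset.mem_Ico.1 hi).2)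
  have h3 : ∏ i ∈ Finset.Ico #(A ∩ B) h, (1 - (i : ℝ) / q) ≤
      Real.exp #(A ∩ B) * ∏ i ∈ Finset.range h, (1 - (i : ℝ) / q) := by
    rw [← Finset.prod_range_mul_prod_Ico _ hs, ← mul_assoc]
    refine le_mul_of_one_le_left hI ?_
    have := mul_le_mul_of_nonneg_left (exp_neg_le_prod_one_sub_div hq (hs.trans hh))
      (Real.exp_pos (#(A ∩ B) : ℝ)).le
    rwa [← Real.exp_add, add_neg_cancel, Real.exp_zero] at this
  rw [h1, pow_two]
  calc _ ≤ (q : ℝ) ^ Fintype.card α * (∏ i ∈ Finset.range h, (1 - (i : ℝ) / q)) *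
        (Real.exp #(A ∩ B) * ∏ i ∈ Finset.range h, (1 - (i : ℝ) / q)) :=
      mul_le_mul_of_nonneg_left h3 (mul_nonneg (by positivity) (Finset.prod_nonneg hpos))
    _ = _ := by ring

/-- Second moment method for rainbow copies of one of the sets `H i` in a random subset of `U`
with a uniformly random `q`-coloring. -/
theorem two_sub_le_rainbow_prob {α ι : Type*} [Fintype α] [Fintype ι] [Nonempty ι]
    (U : Finset α) (H : ι → Finset α) (hU : ∀ i, H i ⊆ U) {h q : ℕ} (hH : ∀ i, #(H i) = h)
    (hq : 0 < q) (hhq : h ≤ q) {p B : ℝ} (hp : 0 < p) (hp1 : p ≤ 1)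
    (hB : ∑ i, ∑ j, (Real.exp 1 / p) ^ #(H i ∩ H j) ≤ B * (Fintype.card ι : ℝ) ^ 2) :
    2 - B ≤ ∑ E ∈ U.powerset, ∑ c : α → Fin q,
      p ^ #E * (1 - p) ^ (#U - #E) * ((q : ℝ) ^ Fintype.card α)⁻¹ *
        (if ∃ i, H i ⊆ E ∧ Set.InjOn c (H i) then 1 else 0) := by
  have hq' : (0 : ℝ) < q := by exact_mod_cast hq
  set N : ℝ := (q : ℝ) ^ Fintype.card α with hN
  have hN0 : 0 < N := by positivity
  set R : ℝ := ∏ i ∈ Finset.range h, (1 - (i : ℝ) / q) with hR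
  have hR0 : 0 < R := lt_of_lt_of_le (Real.exp_pos _) (exp_neg_le_prod_one_sub_div hq hhq)
  have hι : (0 : ℝ) < Fintype.card ι := by exact_mod_cast Fintype.card_pos
  set I : Finset α → (α → Fin q) → ι → ℝ :=
    fun E c i => if H i ⊆ E ∧ Set.InjOn c (H i) then 1 else 0 with hI
  set W : Finset α → ℝ := fun E => p ^ #E * (1 - p) ^ (#U - #E) with hW
  have hW0 : ∀ E, 0 ≤ W E := fun E =>
    mul_nonneg (pow_nonneg hp.le _) (pow_nonneg (by linarith) _)
  have hpair : ∀ i j, ∑ E ∈ U.powerset, ∑ c, W E * N⁻¹ * (I E c i * I E c j) =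
      p ^ #(H i ∪ H j) * (N⁻¹ * rainbowCount q (H i) (H j)) := by
    intro i j
    rw [← sum_powerset_superset_weight U _ (Finset.union_subset (hU i) (hU j)), Finset.sum_mul]
    refine Finset.sum_congr rfl fun E _ => ?_
    rw [rainbowCount, ← Finset.sum_boole, Finset.mul_sum, Finset.mul_sum]
    refine Finset.sum_congr rfl fun c _ => ?_
    simp only [hI, Finset.union_subset_iff]
    by_cases h1 : H i ⊆ E <;> by_cases h2 : H j ⊆ E <;> by_cases h3 : Set.InjOn c (H i) <;>
      by_cases h4 : Set.InjOn c (H j) <;> simp [h1, h2, h3, h4, hW]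
  have hone : ∀ i, ∑ E ∈ U.powerset, ∑ c, W E * N⁻¹ * I E c i = p ^ h * R := by
    intro i
    have h1 := hpair i i
    have h2 : rainbowCount q (H i) (H i) = rainbowCount q ∅ (H i) := by
      simp [rainbowCount]
    rw [h2, rainbowCount_empty_left hq _ (by rw [hH]; exact hhq), Finset.union_idempotent, hH,
      ← hN, inv_mul_cancel_left₀ hN0.ne'] at h1
    rw [← h1]
    refine Finset.sum_congr rfl fun E _ => Finset.sum_congr rfl fun c _ => ?_
    simp only [hI]
    split_ifs <;> simp
  have htwo : ∀ i j, ∑ E ∈ U.powerset, ∑ c, W E * N⁻¹ * (I E c i * I E c j) ≤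
      (p ^ h * R) ^ 2 * (Real.exp 1 / p) ^ #(H i ∩ H j) := by
    intro i j
    rw [hpair]
    have h1 : N⁻¹ * rainbowCount q (H i) (H j) ≤ Real.exp 1 ^ #(H i ∩ H j) * R ^ 2 := by
      rw [inv_mul_le_iff₀ hN0, ← Real.exp_nat_mul, mul_one, ← mul_assoc]
      exact rainbowCount_le hq hhq (hH i) (hH j)
    have h2 : p ^ #(H i ∪ H j) * p ^ #(H i ∩ H j) = (p ^ h) ^ 2 := by
      rw [← pow_add, Finset.card_union_add_card_inter, hH, hH, ← two_mul, mul_comm, pow_mul]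
    calc _ ≤ p ^ #(H i ∪ H j) * (Real.exp 1 ^ #(H i ∩ H j) * R ^ 2) := by gcongr
      _ = (p ^ #(H i ∪ H j) * p ^ #(H i ∩ H j)) * R ^ 2 *
          (Real.exp 1 / p) ^ #(H i ∩ H j) := by
        rw [div_pow]; field_simp
      _ = _ := by rw [h2]; ring
  set t : ℝ := (Fintype.card ι * (p ^ h * R))⁻¹ with ht
  have ht0 : 0 < t := by positivity
  have hpt : ∀ E c, 2 * t * ∑ i, I E c i - t ^ 2 * ∑ i, ∑ j, I E c i * I E c j ≤
      if ∃ i, H i ⊆ E ∧ Set.InjOn c (H i) then 1 else 0 := by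
    intro E c
    split_ifs with hex
    · rw [← Finset.sum_mul_sum]
      nlinarith [sq_nonneg (1 - t * ∑ i, I E c i)]
    · have : ∀ i, I E c i = 0 := fun i => if_neg fun hi => hex ⟨i, hi⟩
      simp [this]
  calc 2 - B ≤ 2 * t * ∑ i, ∑ E ∈ U.powerset, ∑ c, W E * N⁻¹ * I E c i -
        t ^ 2 * ∑ i, ∑ j, ∑ E ∈ U.powerset, ∑ c, W E * N⁻¹ * (I E c i * I E c j) := by
        have h1 : 2 * t * ∑ i, ∑ E ∈ U.powerset, ∑ c, W E * N⁻¹ * I E c i = 2 := by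
          simp only [hone, Finset.sum_const, Finset.card_univ, nsmul_eq_mul]
          rw [mul_assoc, ht, inv_mul_cancel₀ (by positivity), mul_one]
        have h2 : t ^ 2 * ∑ i, ∑ j, ∑ E ∈ U.powerset, ∑ c, W E * N⁻¹ * (I E c i * I E c j) ≤
            B := by
          calc _ ≤ t ^ 2 * ∑ i, ∑ j, (p ^ h * R) ^ 2 * (Real.exp 1 / p) ^ #(H i ∩ H j) := by
                gcongr with i _ j _
                exact htwo i j
            _ = t ^ 2 * (p ^ h * R) ^ 2 * ∑ i, ∑ j, (Real.exp 1 / p) ^ #(H i ∩ H j) := by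
                simp only [← Finset.mul_sum]; ring
            _ ≤ t ^ 2 * (p ^ h * R) ^ 2 * (B * (Fintype.card ι : ℝ) ^ 2) := by gcongr
            _ = B := by rw [ht]; field_simp
        linarith
    _ = ∑ E ∈ U.powerset, ∑ c, W E * N⁻¹ *
        (2 * t * ∑ i, I E c i - t ^ 2 * ∑ i, ∑ j, I E c i * I E c j) := by
        have h1 : ∑ i, ∑ E ∈ U.powerset, ∑ c, W E * N⁻¹ * I E c i =
            ∑ E ∈ U.powerset, ∑ c, W E * N⁻¹ * ∑ i, I E c i := by
          rw [Finset.sum_comm]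
          refine Finset.sum_congr rfl fun E _ => ?_
          rw [Finset.sum_comm]
          simp only [Finset.mul_sum]
        have h2 : ∑ i, ∑ j, ∑ E ∈ U.powerset, ∑ c, W E * N⁻¹ * (I E c i * I E c j) =
            ∑ E ∈ U.powerset, ∑ c, W E * N⁻¹ * ∑ i, ∑ j, I E c i * I E c j := by
          rw [Finset.sum_congr rfl fun i _ => Finset.sum_comm, Finset.sum_comm]
          refine Finset.sum_congr rfl fun E _ => ?_
          rw [Finset.sum_congr rfl fun i _ => Finset.sum_comm, Finset.sum_comm]
          simp only [Finset.mul_sum]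
        rw [h1, h2]
        simp only [mul_sub, Finset.sum_sub_distrib]
        rw [Finset.mul_sum, Finset.mul_sum]
        congr 1 <;>
        · refine Finset.sum_congr rfl fun E _ => ?_
          rw [Finset.mul_sum]
          exact Finset.sum_congr rfl fun c _ => by ring
    _ ≤ _ := by
        refine Finset.sum_le_sum fun E _ => Finset.sum_le_sum fun c _ => ?_
        exact mul_le_mul_of_nonneg_left (hpt E c) (mul_nonneg (hW0 E) (by positivity))

/-- The elements of `S` that are preceded by no other element of `S` at distance less than `r`. -/
noncomputable def runStarts (r : ℕ) (S : Finset ℕ) : Finset ℕ :=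
  S.filter fun i => ∀ j ∈ S, j < i → j + r ≤ i

/-- The weight of a set of indices: `α` for each element and `β` for each run. -/
noncomputable def runWeight (r : ℕ) (α β : ℝ) (S : Finset ℕ) : ℝ :=
  α ^ #S * β ^ #(runStarts r S)

theorem runWeight_nonneg {r : ℕ} {α β : ℝ} (hα : 0 ≤ α) (hβ : 0 ≤ β) (S : Finset ℕ) :
    0 ≤ runWeight r α β S := by
  unfold runWeight; positivity

theorem runWeight_insert_of_far {r t : ℕ} {α β : ℝ} {S : Finset ℕ} (hS : S ⊆ range t)
    (hfar : ∀ j ∈ S, j + r ≤ t) :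
    runWeight r α β (insert t S) = α * β * runWeight r α β S := by
  have ht : t ∉ S := fun h => by simpa using hS h
  have hst : runStarts r (insert t S) = insert t (runStarts r S) := by
    ext i
    simp only [runStarts, mem_filter, mem_insert, forall_eq_or_imp]
    constructor
    · rintro ⟨rfl | h, h1, h2⟩
      · exact Or.inl rfl
      · exact Or.inr ⟨h, h2⟩
    · rintro (rfl | ⟨h, h1⟩)
      · exact ⟨Or.inl rfl, by simp, fun j hj _ => hfar j hj⟩
      · exact ⟨Or.inr h, fun h' => by have := mem_range.1 (hS h); omega, h1⟩
  have ht' : t ∉ runStarts r S := fun h => ht (mem_filter.1 h).1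
  rw [runWeight, runWeight, hst, card_insert_of_notMem ht, card_insert_of_notMem ht']
  ring

theorem runWeight_insert_of_near {r t : ℕ} {α β : ℝ} {S : Finset ℕ} (hS : S ⊆ range t)
    (hnear : ∃ j ∈ S, t < j + r) :
    runWeight r α β (insert t S) = α * runWeight r α β S := by
  have ht : t ∉ S := fun h => by simpa using hS h
  have hst : runStarts r (insert t S) = runStarts r S := by
    ext i
    simp only [runStarts, mem_filter, mem_insert, forall_eq_or_imp]
    constructor
    · rintro ⟨rfl | h, h1, h2⟩
      · obtain ⟨j, hj, hj'⟩ := hnear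
        have := h2 j hj (mem_range.1 (hS hj))
        omega
      · exact ⟨h, h2⟩
    · rintro ⟨h, h1⟩
      exact ⟨Or.inr h, fun h' => by have := mem_range.1 (hS h); omega, h1⟩
  rw [runWeight, runWeight, hst, card_insert_of_notMem ht]
  ring

theorem sum_runWeight_insert_le {r : ℕ} {α β : ℝ} (hα : 0 ≤ α) (hβ : 0 ≤ β)
    (hαr : 2 * α * r ≤ 1) (t : ℕ) :
    ∑ S ∈ (range t).powerset, runWeight r α β (insert t S) ≤
      2 * α * β * ∑ S ∈ (range t).powerset, runWeight r α β S := by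
  induction t using Nat.strong_induction_on with
  | _ t ih =>
  have hw := fun S => runWeight_nonneg (r := r) hα hβ S
  have hinj : ∀ u : ℕ, Set.InjOn (insert u : Finset ℕ → Finset ℕ) (range u).powerset := by
    intro u S hS T hT h
    have hS' : u ∉ S := fun h' => by simpa using (mem_powerset.1 hS) h'
    have hT' : u ∉ T := fun h' => by simpa using (mem_powerset.1 hT) h'
    rw [← erase_insert hS', ← erase_insert hT']
    exact congrArg (fun X => X.erase u) h
  set Z := ∑ S ∈ (range t).powerset, runWeight r α β S with hZ
  have hZ0 : 0 ≤ Z := sum_nonneg fun S _ => hw S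
  set N := (range t).filter fun u => t < u + r with hN
  have hNr : (#N : ℝ) ≤ r := by
    have : N ⊆ Ico (t - r) t := fun u hu => by
      simp only [hN, mem_filter, mem_range] at hu
      simp only [mem_Ico]; omega
    have := card_le_card this
    rw [Nat.card_Ico] at this
    exact_mod_cast (by omega : #N ≤ r)
  have hpt : ∀ S ∈ (range t).powerset, runWeight r α β (insert t S) ≤
      α * β * runWeight r α β S + α * ∑ u ∈ N,
        if S ∈ (range u).powerset.image (insert u) then runWeight r α β S else 0 := by
    intro S hS
    rw [mem_powerset] at hS
    have hpos : ∀ u ∈ N, 0 ≤ if S ∈ (range u).powerset.image (insert u) then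
        runWeight r α β S else 0 := fun u _ => by
      split_ifs
      exacts [hw S, le_rfl]
    by_cases h : ∃ j ∈ S, t < j + r
    · rw [runWeight_insert_of_near hS h]
      obtain ⟨j, hj, hjt⟩ := h
      have hne : S.Nonempty := ⟨j, hj⟩
      set u := S.max' hne
      have hu : u ∈ S := S.max'_mem hne
      have huN : u ∈ N := by
        simp only [hN, mem_filter]
        exact ⟨hS hu, by have := S.le_max' j hj; omega⟩
      have him : S ∈ (range u).powerset.image (insert u) := by
        refine mem_image.2 ⟨S.erase u, mem_powerset.2 fun x hx => ?_, insert_erase hu⟩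
        have h1 := S.le_max' x (mem_of_mem_erase hx)
        have h2 := ne_of_mem_erase hx
        exact mem_range.2 (lt_of_le_of_ne h1 h2)
      have h1 := single_le_sum hpos huN
      rw [if_pos him] at h1
      have h2 : 0 ≤ α * β * runWeight r α β S := mul_nonneg (mul_nonneg hα hβ) (hw S)
      linarith [mul_le_mul_of_nonneg_left h1 hα]
    · push Not at h
      rw [runWeight_insert_of_far hS h]
      linarith [mul_nonneg hα (sum_nonneg hpos)]
  have hsum : ∀ u ∈ N, ∑ S ∈ (range t).powerset,
      (if S ∈ (range u).powerset.image (insert u) then runWeight r α β S else 0) ≤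
        2 * α * β * Z := by
    intro u hu
    have hut : u < t := by
      simp only [hN, mem_filter, mem_range] at hu; exact hu.1
    rw [← sum_filter]
    calc _ ≤ ∑ S ∈ (range u).powerset.image (insert u), runWeight r α β S :=
          sum_le_sum_of_subset_of_nonneg (fun S hS => (mem_filter.1 hS).2) fun S _ _ => hw S
      _ = ∑ S ∈ (range u).powerset, runWeight r α β (insert u S) := sum_image (hinj u)
      _ ≤ 2 * α * β * ∑ S ∈ (range u).powerset, runWeight r α β S := ih u hut
      _ ≤ _ := by
        refine mul_le_mul_of_nonneg_left ?_ (by positivity)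
        exact sum_le_sum_of_subset_of_nonneg
          (powerset_mono.2 (range_mono hut.le)) fun S _ _ => hw S
  calc _ ≤ ∑ S ∈ (range t).powerset, (α * β * runWeight r α β S + α * ∑ u ∈ N,
        if S ∈ (range u).powerset.image (insert u) then runWeight r α β S else 0) :=
        sum_le_sum hpt
    _ = α * β * Z + α * ∑ u ∈ N, ∑ S ∈ (range t).powerset,
        (if S ∈ (range u).powerset.image (insert u) then runWeight r α β S else 0) := by
        rw [sum_add_distrib, ← mul_sum, ← mul_sum, sum_comm]
    _ ≤ α * β * Z + α * ∑ u ∈ N, 2 * α * β * Z := by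
        gcongr with u hu
        exact hsum u hu
    _ = α * β * Z + (2 * α * #N) * (α * β * Z) := by
        rw [sum_const, nsmul_eq_mul]; ring
    _ ≤ α * β * Z + 1 * (α * β * Z) := by
        gcongr
        exact le_trans (by gcongr) hαr
    _ = _ := by ring

theorem sum_runWeight_insert_le_pow {r : ℕ} {α β : ℝ} (hα : 0 ≤ α) (hβ : 0 ≤ β)
    (hαr : 2 * α * r ≤ 1) (t : ℕ) :
    ∑ S ∈ (range t).powerset, runWeight r α β (insert t S) ≤
      2 * α * β * (1 + 2 * α * β) ^ t := by
  refine (sum_runWeight_insert_le hα hβ hαr t).trans ?_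
  refine mul_le_mul_of_nonneg_left ?_ (by positivity)
  induction t with
  | zero => simp [runWeight, runStarts]
  | succ t ih =>
    rw [range_add_one, sum_powerset_insert (by simp)]
    calc _ ≤ _ := add_le_add_right (sum_runWeight_insert_le hα hβ hαr t) _
      _ = (1 + 2 * α * β) * ∑ S ∈ (range t).powerset, runWeight r α β S := by ring
      _ ≤ (1 + 2 * α * β) * (1 + 2 * α * β) ^ t := by gcongr
      _ = _ := by ring

theorem card_perm_eqOn_le {V : Type*} [Fintype V] (X : Finset V) (π₀ : Equiv.Perm V) :
    #(univ.filter fun π : Equiv.Perm V => ∀ x ∈ X, π x = π₀ x) ≤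
      (Fintype.card V - #X).factorial := by
  have h1 : Fintype.card {f : Equiv.Perm V // ∀ a, ¬ a ∉ X → f a = a} =
      (Fintype.card V - #X).factorial := by
    rw [← Fintype.card_congr (Equiv.Perm.subtypeEquivSubtypePerm fun a => a ∉ X),
      Fintype.card_perm, Fintype.card_subtype_compl, Fintype.card_coe]
  rw [← h1, Fintype.card_subtype]
  refine card_le_card_of_injOn (fun π => π₀⁻¹ * π) (fun π hπ => ?_) fun π _ π' _ h => ?_
  · simp only [coe_filter, Set.mem_ofPred_eq, mem_univ, true_and] at hπ
    simp only [coe_filter, Set.mem_ofPred_eq, mem_univ, true_and, not_not]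
    intro a ha
    simp [hπ a ha]
  · exact mul_left_cancel h

/-- The permutations mapping each edge of the standard cycle with index in `S` to an edge of the
standard cycle. -/
noncomputable def edgeHits (n k l m : ℕ) [NeZero n] (S : Finset ℕ) :
    Finset (Equiv.Perm (ZMod n)) :=
  univ.filter fun π => ∀ i ∈ S, cycEdge n k l π i ∈ (range m).image (cycEdge n k l 1)

theorem card_edgeHits_le {n k l d m r : ℕ} [NeZero n] (hkd : k - l = d) (hk : 0 < k) (hm : 0 < m)
    (hr : ∀ g < r, g * d < k) (S W : Finset ℕ)
    (hW : ∀ x ∈ W, ∃ i ∈ S, ∃ a < k, x = i * d + a)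
    (hinj : Set.InjOn (fun x : ℕ => (x : ZMod n)) W) :
    #(edgeHits n k l m S) ≤ (n - #W).factorial * ((k ^ k) ^ #S * m ^ #(runStarts r S)) := by
  have hex : ∀ (π : Equiv.Perm (ZMod n)) (i : ℕ), ∃ (g : Fin m) (τ : Fin k → Fin k),
      π ∈ edgeHits n k l m S → i ∈ S →
        ∀ a : Fin k, π ((i * d + a : ℕ) : ZMod n) = ((g * d + τ a : ℕ) : ZMod n) := by
    intro π i
    by_cases h : π ∈ edgeHits n k l m S ∧ i ∈ S
    · obtain ⟨g, hg, hgi⟩ := mem_image.1 ((mem_filter.1 h.1).2 i h.2)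
      have h1 : ∀ a : Fin k, ∃ b : Fin k,
          π ((i * d + a : ℕ) : ZMod n) = ((g * d + b : ℕ) : ZMod n) := by
        intro a
        have h2 : π ((i * d + a : ℕ) : ZMod n) ∈ cycEdge n k l π i := by
          rw [cycEdge, hkd]
          exact mem_image_of_mem _ (mem_range.2 a.2)
        rw [← hgi, cycEdge, hkd] at h2
        obtain ⟨b, hb, hb'⟩ := mem_image.1 h2
        exact ⟨⟨b, mem_range.1 hb⟩, hb'.symm⟩
      choose τ hτ using h1
      exact ⟨⟨g, mem_range.1 hg⟩, τ, fun _ _ => hτ⟩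
    · exact ⟨⟨0, hm⟩, id, fun h1 h2 => absurd ⟨h1, h2⟩ h⟩
  choose g τ hgτ using hex
  let code : Equiv.Perm (ZMod n) → (S → Fin k → Fin k) × (runStarts r S → Fin m) :=
    fun π => (fun i => τ π i, fun i => g π i)
  have hcode : ∀ π ∈ edgeHits n k l m S, ∀ π' ∈ edgeHits n k l m S, code π = code π' →
      ∀ i ∈ S, ∀ a < k, π ((i * d + a : ℕ) : ZMod n) = π' ((i * d + a : ℕ) : ZMod n) := by
    intro π hπ π' hπ' hc
    have hτ : ∀ i ∈ S, τ π i = τ π' i := fun i hi =>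
      congrFun (congrArg Prod.fst hc) (⟨i, hi⟩ : S)
    have hg : ∀ i ∈ runStarts r S, g π i = g π' i := fun i hi =>
      congrFun (congrArg Prod.snd hc) (⟨i, hi⟩ : runStarts r S)
    have hγ : ∀ i, i ∈ S → (((g π i : ℕ) * d : ℕ) : ZMod n) = (((g π' i : ℕ) * d : ℕ) : ZMod n) := by
      intro i
      induction i using Nat.strong_induction_on with
      | _ i ih =>
      intro hi
      by_cases his : i ∈ runStarts r S
      · rw [hg i his]
      · simp only [runStarts, mem_filter, hi, true_and, not_forall, not_le] at his
        obtain ⟨j, hj, hji, hjr⟩ := his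
        have ha0 : (i - j) * d < k := hr _ (by omega)
        have hij : i * d + (⟨0, hk⟩ : Fin k) = j * d + (⟨(i - j) * d, ha0⟩ : Fin k) := by
          show i * d + 0 = j * d + (i - j) * d
          rw [← add_mul, Nat.add_sub_cancel' hji.le, add_zero]
        have h1 := hgτ π i hπ hi ⟨0, hk⟩
        have h2 := hgτ π' i hπ' hi ⟨0, hk⟩
        have h3 := hgτ π j hπ hj ⟨(i - j) * d, ha0⟩
        have h4 := hgτ π' j hπ' hj ⟨(i - j) * d, ha0⟩
        rw [← hij] at h3 h4
        rw [Nat.cast_add ((_ : Fin m) * d : ℕ)] at h1 h2 h3 h4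
        have h5 := ih j hji hj
        rw [h5, hτ j hj, ← h4] at h3
        rw [h3, hτ i hi] at h1
        exact add_right_cancel (h1.symm.trans h2)
    intro i hi a ha
    have h1 := hgτ π i hπ hi ⟨a, ha⟩
    have h2 := hgτ π' i hπ' hi ⟨a, ha⟩
    simp only at h1 h2
    rw [h1, h2, Nat.cast_add, Nat.cast_add, hγ i hi, hτ i hi]
  have hcard : #(univ : Finset ((S → Fin k → Fin k) × (runStarts r S → Fin m))) =
      (k ^ k) ^ #S * m ^ #(runStarts r S) := by
    simp [Fintype.card_prod]
  rw [← hcard]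
  refine card_le_mul_card_image_of_maps_to (f := code) (fun _ _ => mem_univ _) _ fun b _ => ?_
  rcases (edgeHits n k l m S |>.filter fun π => code π = b).eq_empty_or_nonempty with h | ⟨π₀, h⟩
  · rw [h]; simp
  rw [mem_filter] at h
  have hX : #(W.image fun x : ℕ => (x : ZMod n)) = #W := card_image_of_injOn hinj
  have := card_perm_eqOn_le (W.image fun x : ℕ => (x : ZMod n)) π₀
  rw [hX, ZMod.card] at this
  refine (card_le_card fun π hπ => ?_).trans this
  rw [mem_filter] at hπ
  simp only [mem_filter, mem_univ, true_and, mem_image, forall_exists_index, and_imp,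
    forall_apply_eq_imp_iff₂]
  intro x hx
  obtain ⟨i, hi, a, ha, rfl⟩ := hW x hx
  exact hcode π hπ.1 π₀ h.1 (hπ.2.trans h.2.symm) i hi a ha

theorem injOn_natCast_zmod {n c : ℕ} {W : Finset ℕ} (hW : W ⊆ Ico c (c + n)) :
    Set.InjOn (fun x : ℕ => (x : ZMod n)) W := by
  intro x hx y hy h
  have hx' := mem_Ico.1 (hW hx)
  have hy' := mem_Ico.1 (hW hy)
  have h' : x ≡ y [MOD n] := (ZMod.natCast_eq_natCast_iff x y n).1 h
  rcases le_total x y with hxy | hxy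
  · have := (Nat.modEq_iff_dvd' hxy).1 h'
    have := Nat.eq_zero_of_dvd_of_lt this (by omega)
    omega
  · have := (Nat.modEq_iff_dvd' hxy).1 h'.symm
    have := Nat.eq_zero_of_dvd_of_lt this (by omega)
    omega

/-- The rotation of a set of cyclic indices modulo `m`. -/
def rotate (m t : ℕ) (S : Finset ℕ) : Finset ℕ := S.image fun i => (i + t) % m

theorem injOn_add_mod (m t : ℕ) : Set.InjOn (fun i => (i + t) % m) (range m : Finset ℕ) := by
  intro i hi j hj h
  simp only [coe_range, Set.mem_Iio] at hi hj
  have : i ≡ j [MOD m] := Nat.ModEq.add_right_cancel' t h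
  exact Nat.ModEq.eq_of_lt_of_lt this hi hj

theorem card_rotate {m : ℕ} (t : ℕ) {S : Finset ℕ} (hS : S ⊆ range m) : #(rotate m t S) = #S :=
  card_image_of_injOn ((injOn_add_mod m t).mono (by exact_mod_cast hS))

theorem rotate_subset {m : ℕ} (hm : 0 < m) (t : ℕ) (S : Finset ℕ) : rotate m t S ⊆ range m := by
  intro x hx
  obtain ⟨i, _, rfl⟩ := mem_image.1 hx
  exact mem_range.2 (Nat.mod_lt _ hm)

theorem mem_rotate_iff {m i : ℕ} (t : ℕ) {S : Finset ℕ} (hS : S ⊆ range m) (hi : i < m) :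
    (i + t) % m ∈ rotate m t S ↔ i ∈ S := by
  refine ⟨fun h => ?_, fun h => mem_image_of_mem _ h⟩
  obtain ⟨j, hj, hji⟩ := mem_image.1 h
  rwa [← injOn_add_mod m t (by exact_mod_cast hS hj) (by simpa using hi) hji]

theorem injOn_rotate (m t : ℕ) : Set.InjOn (rotate m t) (range m).powerset := by
  intro S hS T hT h
  have hS' : S ⊆ range m := mem_powerset.1 hS
  have hT' : T ⊆ range m := mem_powerset.1 hT
  ext i
  by_cases hi : i < m
  · rw [← mem_rotate_iff t hS' hi, h, mem_rotate_iff t hT' hi]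
  · exact ⟨fun h => absurd (mem_range.1 (hS' h)) hi, fun h => absurd (mem_range.1 (hT' h)) hi⟩

theorem card_edgeHits_rotate {n k l d m : ℕ} [NeZero n] (hkd : k - l = d) (hn : n = d * m)
    (t : ℕ) (S : Finset ℕ) :
    #(edgeHits n k l m (rotate m t S)) = #(edgeHits n k l m S) := by
  have hedge : ∀ (π : Equiv.Perm (ZMod n)) (i : ℕ), cycEdge n k l π ((i + t) % m) =
      cycEdge n k l (π * Equiv.addRight ((t * d : ℕ) : ZMod n)) i := by
    intro π i
    unfold cycEdge
    rw [hkd]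
    refine image_congr fun a _ => ?_
    simp only [Equiv.Perm.coe_mul, Function.comp_apply, Equiv.coe_addRight]
    congr 1
    have h0 : ((m * d : ℕ) : ZMod n) = 0 := by rw [mul_comm, ← hn, ZMod.natCast_self]
    have h1 := congrArg (fun x : ℕ => ((x * d : ℕ) : ZMod n)) (Nat.mod_add_div (i + t) m)
    have h2 : (((i + t) % m + m * ((i + t) / m)) * d : ℕ) =
      (i + t) % m * d + m * d * ((i + t) / m) := by ring
    rw [h2, Nat.cast_add, Nat.cast_mul (m * d), h0, zero_mul, add_zero] at h1
    rw [Nat.cast_add, h1]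
    push_cast
    ring
  refine card_bij' (fun π _ => π * Equiv.addRight ((t * d : ℕ) : ZMod n))
    (fun π _ => π * (Equiv.addRight ((t * d : ℕ) : ZMod n))⁻¹) ?_ ?_ ?_ ?_
  · intro π hπ
    simp only [edgeHits, rotate, mem_filter, mem_univ, true_and, forall_mem_image] at hπ ⊢
    exact fun i hi => hedge π i ▸ hπ hi
  · intro π hπ
    simp only [edgeHits, rotate, mem_filter, mem_univ, true_and, forall_mem_image] at hπ ⊢
    intro i hi
    rw [hedge, inv_mul_cancel_right]
    exact hπ i hi
  · intro π _; exact mul_inv_cancel_right _ _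
  · intro π _; exact inv_mul_cancel_right _ _

theorem card_biUnion_Ico_block {d l k : ℕ} (hk : k = l + d) (S : Finset ℕ) :
    #(S.biUnion fun i => Ico (i * d + l) (i * d + k)) = #S * d := by
  rw [card_biUnion, sum_const_nat (m := d)]
  · intro i _; rw [Nat.card_Ico]; omega
  · intro i _ j _ hij
    refine disjoint_left.2 fun x hx hy => ?_
    rw [mem_Ico] at hx hy
    rcases lt_or_gt_of_ne hij with h | h
    · have := Nat.mul_le_mul_right d (Nat.succ_le_of_lt h)
      rw [Nat.succ_mul] at this; omega
    · have := Nat.mul_le_mul_right d (Nat.succ_le_of_lt h)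
      rw [Nat.succ_mul] at this; omega

theorem card_blocks_union_heads {d l k r : ℕ} (hk : k = l + d) (hr : k ≤ r * d) (S : Finset ℕ) :
    #((S.biUnion fun i => Ico (i * d + l) (i * d + k)) ∪
      (runStarts r S).biUnion fun i => Ico (i * d) (i * d + l)) =
        #S * d + #(runStarts r S) * l := by
  have hstart : ∀ i ∈ S, ∀ j ∈ runStarts r S, i < j → i * d + k ≤ j * d := by
    intro i hi j hj hij
    have := Nat.mul_le_mul_right d ((mem_filter.1 hj).2 i hi hij)
    rw [add_mul] at this; omega
  rw [card_union_of_disjoint, card_biUnion_Ico_block hk, card_biUnion, sum_const_nat (m := l)]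
  · intro i _; rw [Nat.card_Ico]; omega
  · intro i hi j hj hij
    refine disjoint_left.2 fun x hx hy => ?_
    rw [mem_Ico] at hx hy
    rcases lt_or_gt_of_ne hij with h | h
    · have := hstart i (mem_filter.1 hi).1 j hj h; omega
    · have := hstart j (mem_filter.1 hj).1 i hi h; omega
  · rw [disjoint_left]
    intro x hx hy
    obtain ⟨i, hi, hx⟩ := mem_biUnion.1 hx
    obtain ⟨j, hj, hy⟩ := mem_biUnion.1 hy
    rw [mem_Ico] at hx hy
    rcases lt_or_ge i j with h | h
    · have := hstart i hi j hj h; omega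
    · have := Nat.mul_le_mul_right d h; omega

/-- The indices in `S` followed cyclically modulo `m` by no element of `S` at distance less than
`r`. -/
noncomputable def cyclicEnds (m r : ℕ) (S : Finset ℕ) : Finset ℕ :=
  S.filter fun i => ∀ g, 0 < g → g < r → (i + g) % m ∉ S

theorem card_edgeHits_div_le {n k l d m r : ℕ} [NeZero n] (hkd : k - l = d) (hk : 0 < k)
    (hm : 0 < m) (hr : ∀ g < r, g * d < k) (S W : Finset ℕ)
    (hW : ∀ x ∈ W, ∃ i ∈ S, ∃ a < k, x = i * d + a)
    (hinj : Set.InjOn (fun x : ℕ => (x : ZMod n)) W) :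
    (#(edgeHits n k l m S) : ℝ) / n.factorial ≤
      ((k : ℝ) ^ k) ^ #S * (m : ℝ) ^ #(runStarts r S) * (Real.exp 1 / n) ^ #W := by
  have hWn : #W ≤ n := by
    have h1 := card_le_univ (W.image fun x : ℕ => (x : ZMod n))
    rwa [card_image_of_injOn hinj, ZMod.card] at h1
  have h := card_edgeHits_le hkd hk hm hr S W hW hinj
  have h' : (#(edgeHits n k l m S) : ℝ) ≤
      (n - #W).factorial * (((k : ℝ) ^ k) ^ #S * (m : ℝ) ^ #(runStarts r S)) := by
    exact_mod_cast h
  calc _ ≤ ((n - #W).factorial * (((k : ℝ) ^ k) ^ #S * (m : ℝ) ^ #(runStarts r S))) /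
        n.factorial := by gcongr
    _ = ((k : ℝ) ^ k) ^ #S * (m : ℝ) ^ #(runStarts r S) *
        ((n - #W).factorial / n.factorial) := by ring
    _ ≤ _ := by
        gcongr
        exact factorial_sub_div_factorial_le (Nat.pos_of_ne_zero (NeZero.ne n)) hWn

theorem pow_mul_card_edgeHits_le_runWeight {n k l d m r : ℕ} [NeZero n] (hkd : k = l + d)
    (hd : 0 < d) (hm : 0 < m) (hn : n = d * m) (hr : ∀ g < r, g * d < k) (hr' : k ≤ r * d)
    {w : ℝ} (hw : 0 ≤ w) {S : Finset ℕ} (hS : S ⊆ range m) (hS' : ∀ x ∈ S, r ≤ x + 1) :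
    w ^ #S * ((#(edgeHits n k l m S) : ℝ) / n.factorial) ≤
      runWeight r (w * (k : ℝ) ^ k * (Real.exp 1 / n) ^ d) (m * (Real.exp 1 / n) ^ l) S := by
  set W := (S.biUnion fun i => Ico (i * d + l) (i * d + k)) ∪
    (runStarts r S).biUnion fun i => Ico (i * d) (i * d + l) with hWdef
  have hW : ∀ x ∈ W, ∃ i ∈ S, ∃ a < k, x = i * d + a := by
    intro x hx
    simp only [hWdef, mem_union, mem_biUnion, mem_Ico] at hx
    rcases hx with ⟨i, hi, h⟩ | ⟨i, hi, h⟩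
    · exact ⟨i, hi, x - i * d, by omega, by omega⟩
    · exact ⟨i, (mem_filter.1 hi).1, x - i * d, by omega, by omega⟩
  have hsub : W ⊆ Ico ((r - 1) * d) ((r - 1) * d + n) := by
    intro x hx
    obtain ⟨i, hi, a, ha, rfl⟩ := hW x hx
    have h1 : r - 1 ≤ i := by have := hS' i hi; omega
    have h2 : i + 1 ≤ m := mem_range.1 (hS hi)
    have h3 := Nat.mul_le_mul_right d h1
    have h4 := Nat.mul_le_mul_right d h2
    have h5 : r * d ≤ (r - 1) * d + d := by
      rw [← Nat.succ_mul]; exact Nat.mul_le_mul_right d (by omega)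
    rw [add_mul] at h4
    rw [mem_Ico, hn, mul_comm d m]
    omega
  have h := card_edgeHits_div_le (by omega : k - l = d) (by omega) hm hr S W hW
    (injOn_natCast_zmod hsub)
  rw [hWdef, card_blocks_union_heads hkd hr'] at h
  calc _ ≤ w ^ #S * _ := mul_le_mul_of_nonneg_left h (by positivity)
    _ = _ := by
      rw [runWeight, pow_add, mul_comm #S d, mul_comm _ l, pow_mul, pow_mul]
      ring

theorem card_runStarts_le_one {m r : ℕ} {S : Finset ℕ} (hS : S ⊆ range m)
    (hend : cyclicEnds m r S = ∅) : #(runStarts r S) ≤ 1 := by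
  have key : ∀ s ∈ runStarts r S, ∀ j ∈ S, ¬ j < s := by
    intro s hs j hj hjs
    obtain ⟨hsS, hs⟩ := mem_filter.1 hs
    set P := S.filter fun j => j < s
    have hP : P.Nonempty := ⟨j, mem_filter.2 ⟨hj, hjs⟩⟩
    set u := P.max' hP
    obtain ⟨huS, hus⟩ := mem_filter.1 (P.max'_mem hP)
    have hsm := mem_range.1 (hS hsS)
    have hur := hs u huS hus
    have hu : u ∉ cyclicEnds m r S := by simp [hend]
    simp only [cyclicEnds, mem_filter, not_and, not_forall, not_not] at hu
    obtain ⟨g, hg, hgr, hgS⟩ := hu huS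
    rw [Nat.mod_eq_of_lt (by omega)] at hgS
    have := P.le_max' (u + g) (mem_filter.2 ⟨hgS, by omega⟩)
    omega
  rw [card_le_one]
  intro a ha b hb
  have h1 := key a ha b (mem_filter.1 hb).1
  have h2 := key b hb a (mem_filter.1 ha).1
  omega

theorem le_mul_card_of_cyclicEnds_eq_empty {m r : ℕ} {S : Finset ℕ}
    (hS : S ⊆ range m) (hne : S.Nonempty) (hend : cyclicEnds m r S = ∅) : m ≤ #S * r := by
  have hcover : range m ⊆ (S ×ˢ range r).image fun q => (q.1 + q.2) % m := by
    intro x hx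
    have hx := mem_range.1 hx
    obtain ⟨i, hi, hmin⟩ := S.exists_min_image (fun i => (x + (m - i)) % m) hne
    have him := mem_range.1 (hS hi)
    set δ := (x + (m - i)) % m with hδ
    have hδm : δ < m := Nat.mod_lt _ (by omega)
    have hiδ : (i + δ) % m = x := by
      rw [hδ, Nat.add_mod_mod, show i + (x + (m - i)) = x + m by omega, Nat.add_mod_right,
        Nat.mod_eq_of_lt hx]
    by_cases hδr : δ < r
    · exact mem_image.2 ⟨(i, δ), mem_product.2 ⟨hi, mem_range.2 hδr⟩, hiδ⟩
    exfalso
    have hu : i ∉ cyclicEnds m r S := by simp [hend]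
    simp only [cyclicEnds, mem_filter, not_and, not_forall, not_not] at hu
    obtain ⟨g, hg, hgr, hgS⟩ := hu hi
    have h1 := hmin _ hgS
    have h2 : (x + (m - (i + g) % m)) % m = δ - g := by
      have hlt : (i + g) % m < m := Nat.mod_lt _ (by omega)
      have h3 : (x + (m - (i + g) % m)) ≡ δ - g [MOD m] := by
        refine Nat.ModEq.add_right_cancel' ((i + g) % m) ?_
        have e1 : x + (m - (i + g) % m) + (i + g) % m = x + m := by omega
        rw [e1]
        have e2 : δ - g + (i + g) % m ≡ δ - g + (i + g) [MOD m] :=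
          (Nat.mod_modEq (i + g) m).add_left _
        refine Nat.ModEq.trans ?_ e2.symm
        rw [show δ - g + (i + g) = i + δ by omega]
        change (x + m) % m = (i + δ) % m
        rw [hiδ, Nat.add_mod_right, Nat.mod_eq_of_lt hx]
      have h4 : (x + (m - (i + g) % m)) % m = (δ - g) % m := h3
      rw [h4, Nat.mod_eq_of_lt (by omega)]
    omega
  have := (card_le_card hcover).trans card_image_le
  simpa using this

theorem pow_mul_card_edgeHits_le_of_cyclicEnds_eq_empty {n k l d m r : ℕ} [NeZero n]
    (hkd : k = l + d) (hd : 0 < d) (hm : 0 < m) (hn : n = d * m) (hr : ∀ g < r, g * d < k)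
    {w : ℝ} (hw : 0 ≤ w) {S : Finset ℕ} (hS : S ⊆ range m) (hend : cyclicEnds m r S = ∅) :
    w ^ #S * ((#(edgeHits n k l m S) : ℝ) / n.factorial) ≤
      m * (w * (k : ℝ) ^ k * (Real.exp 1 / n) ^ d) ^ #S := by
  set W := S.biUnion fun i => Ico (i * d + l) (i * d + k) with hWdef
  have hsub : W ⊆ Ico l (l + n) := by
    intro x hx
    simp only [hWdef, mem_biUnion, mem_Ico] at hx
    obtain ⟨i, hi, h⟩ := hx
    have h4 := Nat.mul_le_mul_right d (Nat.succ_le_of_lt (mem_range.1 (hS hi)))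
    rw [Nat.succ_mul] at h4
    rw [mem_Ico, hn, mul_comm d m]
    omega
  have h := card_edgeHits_div_le (by omega : k - l = d) (by omega) hm hr S W (fun x hx => by
    simp only [hWdef, mem_biUnion, mem_Ico] at hx
    obtain ⟨i, hi, h⟩ := hx
    exact ⟨i, hi, x - i * d, by omega, by omega⟩) (injOn_natCast_zmod hsub)
  rw [hWdef, card_biUnion_Ico_block hkd] at h
  have hm1 : (1 : ℝ) ≤ m := by exact_mod_cast hm
  have h1 : (m : ℝ) ^ #(runStarts r S) ≤ m := by
    simpa using pow_le_pow_right₀ hm1 (card_runStarts_le_one hS hend)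
  calc _ ≤ w ^ #S * _ := mul_le_mul_of_nonneg_left h (by positivity)
    _ ≤ w ^ #S * (((k : ℝ) ^ k) ^ #S * m * (Real.exp 1 / n) ^ (#S * d)) := by gcongr
    _ = _ := by
      rw [mul_comm #S d, pow_mul]
      ring

theorem cyclicEnds_rotate {m r t : ℕ} (hm : 0 < m) {S : Finset ℕ} (hS : S ⊆ range m)
    {i : ℕ} (hi : i ∈ cyclicEnds m r S) : (i + t) % m ∈ cyclicEnds m r (rotate m t S) := by
  obtain ⟨hiS, hi⟩ := mem_filter.1 hi
  refine mem_filter.2 ⟨mem_image_of_mem _ hiS, fun g hg hgr => ?_⟩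
  have h := hi g hg hgr
  rwa [← mem_rotate_iff t hS (Nat.mod_lt _ hm), Nat.mod_add_mod,
    show i + g + t = i + t + g by ring, ← Nat.mod_add_mod] at h

theorem sum_pow_mul_card_edgeHits_le {n k l d m r : ℕ} [NeZero n] (hkd : k = l + d)
    (hd : 0 < d) (hm : 0 < m) (hn : n = d * m) (hr : ∀ g < r, g * d < k)
    (hr' : k ≤ r * d) {w α β : ℝ} (hw : 0 ≤ w)
    (hα : α = w * (k : ℝ) ^ k * (Real.exp 1 / n) ^ d) (hβ : β = m * (Real.exp 1 / n) ^ l)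
    (hαr : 2 * α * r ≤ 1) (hα4 : α ≤ (1 / 4) ^ r) :
    ∑ S ∈ (range m).powerset, w ^ #S * ((#(edgeHits n k l m S) : ℝ) / n.factorial) ≤
      1 + m * (2 * α * β * (1 + 2 * α * β) ^ m) + m * (1 / 2) ^ m := by
  set f : Finset ℕ → ℝ := fun S => w ^ #S * ((#(edgeHits n k l m S) : ℝ) / n.factorial) with hf
  have hf0 : ∀ S, 0 ≤ f S := fun S => by positivity
  have hα0 : 0 ≤ α := by rw [hα]; positivity
  have hβ0 : 0 ≤ β := by rw [hβ]; positivity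
  have hempty : f ∅ ≤ 1 := by
    simp only [hf, card_empty, pow_zero, one_mul]
    refine div_le_one_of_le₀ ?_ (by positivity)
    have h := card_le_univ (edgeHits n k l m ∅)
    rw [Fintype.card_perm, ZMod.card] at h
    exact_mod_cast h
  have hnoend : ∀ S ∈ (range m).powerset,
      (if S.Nonempty ∧ cyclicEnds m r S = ∅ then f S else 0) ≤ m * (1 / 4) ^ m := by
    intro S hS
    rw [mem_powerset] at hS
    split_ifs with h
    · refine (pow_mul_card_edgeHits_le_of_cyclicEnds_eq_empty hkd hd hm hn hr hw hS h.2).trans ?_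
      rw [← hα]
      gcongr
      calc α ^ #S ≤ ((1 / 4) ^ r) ^ #S := by gcongr
        _ = (1 / 4) ^ (#S * r) := by rw [← pow_mul, mul_comm]
        _ ≤ (1 / 4) ^ m := pow_le_pow_of_le_one (by norm_num) (by norm_num)
          (le_mul_card_of_cyclicEnds_eq_empty hS h.1 h.2)
    · positivity
  have hlast : ∑ S ∈ (range m).powerset, (if m - 1 ∈ cyclicEnds m r S then f S else 0) ≤
      2 * α * β * (1 + 2 * α * β) ^ m := by
    rw [← sum_filter]
    have hsub : (range m).powerset.filter (fun S => m - 1 ∈ cyclicEnds m r S) ⊆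
        (range (m - 1)).powerset.image (insert (m - 1)) := by
      intro S hS
      rw [mem_filter, mem_powerset] at hS
      have h1 : m - 1 ∈ S := (mem_filter.1 hS.2).1
      refine mem_image.2 ⟨S.erase (m - 1), mem_powerset.2 fun x hx => ?_, insert_erase h1⟩
      have h2 := mem_range.1 (hS.1 (mem_of_mem_erase hx))
      have h3 := ne_of_mem_erase hx
      exact mem_range.2 (by omega)
    have hinj : Set.InjOn (insert (m - 1) : Finset ℕ → Finset ℕ) (range (m - 1)).powerset := by
      intro S hS T hT h
      have hS' : m - 1 ∉ S := fun h' => by simpa using (mem_powerset.1 hS) h'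
      have hT' : m - 1 ∉ T := fun h' => by simpa using (mem_powerset.1 hT) h'
      rw [← erase_insert hS', ← erase_insert hT']
      exact congrArg (fun X => X.erase (m - 1)) h
    calc _ ≤ ∑ S ∈ (range m).powerset.filter (fun S => m - 1 ∈ cyclicEnds m r S),
          runWeight r α β S := by
          refine sum_le_sum fun S hS => ?_
          rw [mem_filter, mem_powerset] at hS
          rw [hα, hβ]
          refine pow_mul_card_edgeHits_le_runWeight hkd hd hm hn hr hr' hw hS.1 fun x hx => ?_
          by_contra hlt
          refine (mem_filter.1 hS.2).2 (x + 1) (by omega) (by omega) ?_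
          rwa [show m - 1 + (x + 1) = x + m by omega, Nat.add_mod_right,
            Nat.mod_eq_of_lt (mem_range.1 (hS.1 hx))]
      _ ≤ ∑ S ∈ (range (m - 1)).powerset.image (insert (m - 1)), runWeight r α β S :=
          sum_le_sum_of_subset_of_nonneg hsub fun S _ _ => runWeight_nonneg hα0 hβ0 S
      _ = ∑ S ∈ (range (m - 1)).powerset, runWeight r α β (insert (m - 1) S) := sum_image hinj
      _ ≤ 2 * α * β * (1 + 2 * α * β) ^ (m - 1) := sum_runWeight_insert_le_pow hα0 hβ0 hαr _
      _ ≤ _ := by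
          gcongr
          · exact le_add_of_nonneg_right (by positivity)
          · omega
  have hrot : ∀ t ∈ range m, ∑ S ∈ (range m).powerset,
      (if t ∈ cyclicEnds m r S then f S else 0) ≤ 2 * α * β * (1 + 2 * α * β) ^ m := by
    intro t ht
    rw [mem_range] at ht
    refine le_trans ?_ hlast
    rw [← sum_filter, ← sum_filter]
    set s := m - 1 - t with hs
    calc _ = ∑ S ∈ (range m).powerset.filter (fun S => t ∈ cyclicEnds m r S),
          f (rotate m s S) := by
          refine sum_congr rfl fun S hS => ?_
          rw [mem_filter, mem_powerset] at hS
          simp only [hf]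
          rw [card_rotate s hS.1, card_edgeHits_rotate (by omega : k - l = d) hn]
      _ = ∑ S ∈ ((range m).powerset.filter fun S => t ∈ cyclicEnds m r S).image (rotate m s),
          f S := by
          rw [sum_image]
          exact (injOn_rotate m s).mono (by exact_mod_cast filter_subset _ _)
      _ ≤ _ := by
          refine sum_le_sum_of_subset_of_nonneg (fun T hT => ?_) fun S _ _ => hf0 S
          obtain ⟨S, hS, rfl⟩ := mem_image.1 hT
          rw [mem_filter, mem_powerset] at hS ⊢
          refine ⟨rotate_subset hm s S, ?_⟩
          have h := cyclicEnds_rotate (t := s) hm hS.1 hS.2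
          rwa [show t + s = m - 1 by omega, Nat.mod_eq_of_lt (by omega)] at h
  have hpt : ∀ S ∈ (range m).powerset, f S ≤ (if S = ∅ then f S else 0) +
      (∑ t ∈ range m, if t ∈ cyclicEnds m r S then f S else 0) +
      if S.Nonempty ∧ cyclicEnds m r S = ∅ then f S else 0 := by
    intro S hS
    rw [mem_powerset] at hS
    have h0 : ∀ t ∈ range m, 0 ≤ if t ∈ cyclicEnds m r S then f S else 0 := fun t _ => by
      split_ifs
      exacts [hf0 S, le_rfl]
    have h1 := sum_nonneg h0
    rcases S.eq_empty_or_nonempty with h | h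
    · rw [if_pos h, if_neg (by simp [h])]
      linarith
    · rw [if_neg h.ne_empty]
      by_cases h2 : cyclicEnds m r S = ∅
      · rw [if_pos ⟨h, h2⟩]; linarith
      · rw [if_neg (by simp [h2])]
        obtain ⟨t, ht⟩ := nonempty_iff_ne_empty.2 h2
        have h3 := single_le_sum h0 (hS (mem_filter.1 ht).1)
        rw [if_pos ht] at h3
        linarith
  calc _ ≤ ∑ S ∈ (range m).powerset, ((if S = ∅ then f S else 0) +
        (∑ t ∈ range m, if t ∈ cyclicEnds m r S then f S else 0) +
        if S.Nonempty ∧ cyclicEnds m r S = ∅ then f S else 0) := sum_le_sum hpt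
    _ = f ∅ + ∑ t ∈ range m, ∑ S ∈ (range m).powerset,
          (if t ∈ cyclicEnds m r S then f S else 0) +
        ∑ S ∈ (range m).powerset, if S.Nonempty ∧ cyclicEnds m r S = ∅ then f S else 0 := by
        rw [sum_add_distrib, sum_add_distrib, sum_comm (s := range m)]
        simp
    _ ≤ 1 + ∑ _t ∈ range m, 2 * α * β * (1 + 2 * α * β) ^ m +
        ∑ _S ∈ (range m).powerset, (m : ℝ) * (1 / 4) ^ m :=
        add_le_add (add_le_add hempty (sum_le_sum hrot)) (sum_le_sum hnoend)
    _ = _ := by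
        simp only [sum_const, card_powerset, card_range, nsmul_eq_mul]
        push_cast
        have h : (2 : ℝ) ^ m * (1 / 4) ^ m = (1 / 2) ^ m := by rw [← mul_pow]; norm_num
        rw [mul_left_comm, mul_left_comm ((2 : ℝ) ^ m), h]

theorem cycEdge_mul (n k l : ℕ) [NeZero n] (σ π : Equiv.Perm (ZMod n)) (i : ℕ) :
    cycEdge n k l (σ * π) i = (cycEdge n k l π i).image σ := by
  rw [cycEdge, cycEdge, image_image]
  rfl

/-- The edge set of the cycle of length `m` determined by the vertex ordering `σ`. -/
noncomputable def cycEdges (n k l m : ℕ) [NeZero n] (σ : Equiv.Perm (ZMod n)) :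
    Finset (Finset (ZMod n)) :=
  (range m).image (cycEdge n k l σ)

theorem cycEdges_mul (n k l m : ℕ) [NeZero n] (σ π : Equiv.Perm (ZMod n)) :
    cycEdges n k l m (σ * π) = (cycEdges n k l m π).image (Finset.image σ) := by
  rw [cycEdges, cycEdges, image_image]
  exact image_congr fun i _ => cycEdge_mul n k l σ π i

theorem card_cycEdge {n k l : ℕ} [NeZero n] (hkn : k ≤ n) (σ : Equiv.Perm (ZMod n)) (i : ℕ) :
    #(cycEdge n k l σ i) = k := by
  rw [cycEdge, card_image_of_injOn, card_range]
  intro a ha b hb h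
  simp only [coe_range, Set.mem_Iio] at ha hb
  have h1 := σ.injective h
  rw [Nat.cast_add, Nat.cast_add] at h1
  exact injOn_natCast_zmod (W := range n) (c := 0) (by simp)
    (by simpa using ha.trans_le hkn) (by simpa using hb.trans_le hkn) (add_left_cancel h1)

theorem pow_card_inter_cycEdges_le {n k l m : ℕ} [NeZero n] {w : ℝ} (hw : 0 ≤ w)
    (π : Equiv.Perm (ZMod n)) :
    w ^ #(cycEdges n k l m 1 ∩ cycEdges n k l m π) ≤
      ∑ S ∈ (range m).powerset, if π ∈ edgeHits n k l m S then w ^ #S else 0 := by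
  set J := (range m).filter fun i => cycEdge n k l π i ∈ cycEdges n k l m 1 with hJ
  have h1 : #(cycEdges n k l m 1 ∩ cycEdges n k l m π) ≤ #J := by
    refine (card_le_card fun e he => ?_).trans (card_image_le (s := J) (f := cycEdge n k l π))
    obtain ⟨he1, he2⟩ := mem_inter.1 he
    obtain ⟨i, hi, rfl⟩ := mem_image.1 he2
    exact mem_image_of_mem _ (mem_filter.2 ⟨hi, he1⟩)
  have h2 : (range m).powerset.filter (fun S => π ∈ edgeHits n k l m S) = J.powerset := by
    ext S
    rw [mem_filter, mem_powerset, mem_powerset, edgeHits, mem_filter, hJ, ← cycEdges]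
    exact ⟨fun h i hi => mem_filter.2 ⟨h.1 hi, h.2.2 i hi⟩, fun h =>
      ⟨fun i hi => (mem_filter.1 (h hi)).1, mem_univ _, fun i hi => (mem_filter.1 (h hi)).2⟩⟩
  rw [← sum_filter, h2]
  calc _ ≤ (w + 1) ^ #(cycEdges n k l m 1 ∩ cycEdges n k l m π) := by gcongr; linarith
    _ ≤ (w + 1) ^ #J := pow_le_pow_right₀ (by linarith) h1
    _ = _ := by rw [← sum_pow_mul_eq_add_pow]; simp

theorem sum_sum_pow_card_inter_cycEdges_le {n k l m : ℕ} [NeZero n] {w B : ℝ} (hw : 0 ≤ w)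
    (hB : ∑ S ∈ (range m).powerset, w ^ #S * ((#(edgeHits n k l m S) : ℝ) / n.factorial) ≤ B) :
    ∑ σ, ∑ π, w ^ #(cycEdges n k l m σ ∩ cycEdges n k l m π) ≤
      B * (Fintype.card (Equiv.Perm (ZMod n)) : ℝ) ^ 2 := by
  have hcard : Fintype.card (Equiv.Perm (ZMod n)) = n.factorial := by
    rw [Fintype.card_perm, ZMod.card]
  have hfac : (0 : ℝ) < n.factorial := by positivity
  have h1 : ∑ π, w ^ #(cycEdges n k l m 1 ∩ cycEdges n k l m π) ≤ B * n.factorial := by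
    calc _ ≤ ∑ π, ∑ S ∈ (range m).powerset,
          (if π ∈ edgeHits n k l m S then w ^ #S else 0) :=
          sum_le_sum fun π _ => pow_card_inter_cycEdges_le hw π
      _ = (∑ S ∈ (range m).powerset,
          w ^ #S * ((#(edgeHits n k l m S) : ℝ) / n.factorial)) * n.factorial := by
          rw [sum_comm, sum_mul]
          refine sum_congr rfl fun S _ => ?_
          rw [sum_ite_mem, univ_inter, sum_const, nsmul_eq_mul]
          field_simp
      _ ≤ _ := by gcongr
  have h2 : ∀ σ, ∑ π, w ^ #(cycEdges n k l m σ ∩ cycEdges n k l m π) ≤ B * n.factorial := by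
    intro σ
    refine le_trans (le_of_eq ?_) h1
    rw [← Equiv.sum_comp (Equiv.mulLeft σ)]
    refine sum_congr rfl fun π _ => ?_
    have hσ : cycEdges n k l m σ = (cycEdges n k l m 1).image (Finset.image σ) := by
      rw [← cycEdges_mul, mul_one]
    have hinj : Function.Injective (Finset.image σ) := image_injective σ.injective
    rw [Equiv.coe_mulLeft, cycEdges_mul, hσ, ← image_inter _ _ hinj,
      card_image_of_injective _ hinj]
  calc _ ≤ ∑ _σ : Equiv.Perm (ZMod n), B * (n.factorial : ℝ) := sum_le_sum fun σ _ => h2 σ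
    _ = _ := by
      rw [sum_const, card_univ, hcard, nsmul_eq_mul]; ring

theorem two_sub_le_rainbowHamCycleProb {n k l m qc : ℕ} [NeZero n] (hkn : k ≤ n)
    (hm : n / (k - l) = m) (hm0 : 0 < m) (hmq : m ≤ qc) {p B : ℝ} (hp : 0 < p) (hp1 : p ≤ 1)
    (hB : ∑ S ∈ (range m).powerset,
      (Real.exp 1 / p) ^ #S * ((#(edgeHits n k l m S) : ℝ) / n.factorial) ≤ B) :
    2 - B ≤ rainbowHamCycleProb n k l qc p := by
  have hU : ∀ σ, cycEdges n k l m σ ⊆ univ.filter fun S : Finset (ZMod n) => #S = k := by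
    intro σ e he
    obtain ⟨i, _, rfl⟩ := mem_image.1 he
    simp [card_cycEdge hkn]
  have hH : ∀ σ, #(cycEdges n k l m σ) = #(cycEdges n k l m 1) := fun σ => by
    rw [← mul_one σ, cycEdges_mul, card_image_of_injective _ (image_injective σ.injective)]
  have hcard : #(cycEdges n k l m 1) ≤ qc :=
    (card_image_le.trans_eq (card_range m)).trans hmq
  have hsum := sum_sum_pow_card_inter_cycEdges_le (by positivity) hB
  have h := two_sub_le_rainbow_prob _ (cycEdges n k l m) hU hH (hm0.trans_le hmq) hcard hp hp1
    (by convert hsum)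
  have hiff (E : Finset (Finset (ZMod n))) (c : Finset (ZMod n) → Fin qc)
      (σ : Equiv.Perm (ZMod n)) :
      (cycEdges n k l m σ ⊆ E ∧ Set.InjOn c (cycEdges n k l m σ)) ↔
        (∀ i < n / (k - l), cycEdge n k l σ i ∈ E) ∧
          (∀ i < n / (k - l), ∀ j < n / (k - l),
            c (cycEdge n k l σ i) = c (cycEdge n k l σ j) →
              cycEdge n k l σ i = cycEdge n k l σ j) := by
    rw [hm, cycEdges, image_subset_iff]
    refine and_congr (by simp only [mem_range]) ?_
    simp only [Set.InjOn, mem_coe, forall_mem_image, mem_range]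
  simp only [hiff] at h
  rw [rainbowHamCycleProb]
  convert h

theorem exists_pos_le_quarter_pow (k : ℕ) {D ε : ℝ} (hD : 0 < D) (hε : 0 < ε) :
    ∃ α : ℝ, 0 < α ∧ α ≤ (1 / 4) ^ k ∧
      2 * (α * D) * Real.exp (2 * (α * D)) ≤ ε := by
  refine ⟨min ((1 / 4) ^ k) (min (1 / (2 * D)) (ε / (6 * D))), by positivity, min_le_left _ _, ?_⟩
  set α := min ((1 / 4 : ℝ) ^ k) (min (1 / (2 * D)) (ε / (6 * D)))
  have hα0 : 0 < α := by positivity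
  have h1 : α ≤ 1 / (2 * D) := (min_le_right _ _).trans (min_le_left _ _)
  have h2 : α ≤ ε / (6 * D) := (min_le_right _ _).trans (min_le_right _ _)
  rw [le_div_iff₀ (by positivity)] at h1 h2
  have h3 : Real.exp (2 * (α * D)) ≤ 3 :=
    (Real.exp_le_exp.2 (by linarith : 2 * (α * D) ≤ 1)).trans (by linarith [Real.exp_one_lt_d9])
  calc 2 * (α * D) * Real.exp (2 * (α * D)) ≤ 2 * (α * D) * 3 := by gcongr
    _ ≤ ε := by linarith

/-- For all `2 ≤ ℓ < k` and `ε > 0` there are `K' = K'(k,ε)` and `n₀` such that for all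
`n ≥ n₀` with `(k-ℓ) ∣ n`: if the edges of `G^(k)(n,p)` with `p = K' n^{ℓ-k}` are colored
independently and uniformly at random with `q ≥ n/(k-ℓ)` colors, then with probability at
least `1 - ε` the resulting hypergraph contains a rainbow Hamilton `ℓ`-cycle. -/
theorem rainbow_hamilton_ell_cycle (k l : ℕ) (hl : 2 ≤ l) (hlk : l < k)
    (ε : ℝ) (hε : 0 < ε) :
    ∃ K' : ℝ, 0 < K' ∧ ∃ n₀ : ℕ, ∀ (n : ℕ) [NeZero n], n₀ ≤ n → (k - l) ∣ n →
      ∀ qc : ℕ, n / (k - l) ≤ qc →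
        1 - ε ≤ rainbowHamCycleProb n k l qc (K' * (n : ℝ) ^ ((l : ℤ) - (k : ℤ))) := by
  obtain ⟨d, rfl⟩ : ∃ d, k = l + d := ⟨k - l, by omega⟩
  have hd : 0 < d := by omega
  obtain ⟨k, hk⟩ : ∃ k, k = l + d := ⟨_, rfl⟩
  rw [← hk]
  have hkld : k - l = d := by omega
  have hk0 : (0 : ℝ) < k := by exact_mod_cast (by omega : 0 < k)
  obtain ⟨α, hα0, hαk, hαε⟩ := exists_pos_le_quarter_pow k
    (D := Real.exp 1 ^ l) (ε := ε / 2) (by positivity) (by positivity)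
  set K' : ℝ := Real.exp 1 ^ (d + 1) * (k : ℝ) ^ k / α with hK'
  have hK'0 : 0 < K' := by positivity
  obtain ⟨m₀, hm₀⟩ : ∃ m₀ : ℕ, ∀ m ≥ m₀, (m : ℝ) * (1 / 2) ^ m ≤ ε / 2 := by
    have h := tendsto_self_mul_const_pow_of_lt_one (r := (1 / 2 : ℝ)) (by norm_num) (by norm_num)
    exact Filter.eventually_atTop.1 (h.eventually_le_const (by positivity))
  refine ⟨K', hK'0, d * (m₀ + k) + ⌈K'⌉₊ + k, ?_⟩
  intro n _ hn₀ hdn qc hqc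
  rw [hkld] at hdn hqc
  obtain ⟨m, hnm⟩ := hdn
  have hmk : m₀ + k ≤ m := Nat.le_of_mul_le_mul_left (by omega : d * (m₀ + k) ≤ d * m) hd
  have hm0 : 0 < m := by omega
  have hn0 : (0 : ℝ) < n := by exact_mod_cast (by omega : 0 < n)
  have hmn : m ≤ n := hnm ▸ Nat.le_mul_of_pos_left m hd
  have hdiv : n / d = m := by rw [hnm, Nat.mul_div_cancel_left _ hd]
  rw [hdiv] at hqc
  set p : ℝ := K' * (n : ℝ) ^ ((l : ℤ) - (k : ℤ)) with hp
  have hp' : p = K' / (n : ℝ) ^ d := by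
    rw [hp, show (l : ℤ) - (k : ℤ) = -(d : ℤ) by omega, zpow_neg, zpow_natCast]
    rfl
  have hp0 : 0 < p := by positivity
  have hp1 : p ≤ 1 := by
    rw [hp', div_le_one (by positivity)]
    calc K' ≤ n := (Nat.le_ceil _).trans (by exact_mod_cast (by omega : ⌈K'⌉₊ ≤ n))
      _ ≤ (n : ℝ) ^ d := le_self_pow₀ (by exact_mod_cast (by omega : 1 ≤ n)) hd.ne'
  set r := (k + d - 1) / d with hr
  have hrg : ∀ g < r, g * d < k := by
    intro g hg
    have h1 := (Nat.le_div_iff_mul_le hd).1 (Nat.succ_le_of_lt hg)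
    rw [Nat.succ_mul] at h1
    omega
  have hrk : k ≤ r * d := by
    have h1 := Nat.lt_div_mul_add (a := k + d - 1) hd
    rw [← hr] at h1
    omega
  have hr_le : r ≤ k := by
    by_contra h
    have h1 := hrg k (by omega)
    have := Nat.le_mul_of_pos_right k hd
    omega
  set β : ℝ := m * (Real.exp 1 / n) ^ l with hβ
  have hβ0 : 0 ≤ β := by positivity
  have hα : α = Real.exp 1 / p * (k : ℝ) ^ k * (Real.exp 1 / n) ^ d := by
    rw [hp', hK', div_pow]
    field_simp
    ring
  have hαr : 2 * α * r ≤ 1 := by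
    have h1 : (2 * k : ℕ) ≤ 4 ^ k := by
      rw [show 4 = 2 * 2 by rfl, mul_pow]
      exact Nat.mul_le_mul (Nat.le_self_pow (by omega) 2) Nat.lt_two_pow_self.le
    have h2 : (2 * k : ℝ) ≤ 4 ^ k := by exact_mod_cast h1
    calc 2 * α * r ≤ 2 * (1 / 4) ^ k * k := by gcongr
      _ = (2 * k) * (1 / 4) ^ k := by ring
      _ ≤ 4 ^ k * (1 / 4) ^ k := by gcongr
      _ = 1 := by rw [← mul_pow]; norm_num
  have hα4 : α ≤ (1 / 4) ^ r :=
    hαk.trans (pow_le_pow_of_le_one (by norm_num) (by norm_num) hr_le)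
  have hsum := sum_pow_mul_card_edgeHits_le hk hd hm0 hnm hrg hrk
    (div_nonneg (Real.exp_pos 1).le hp0.le) hα hβ hαr hα4
  have hmβ : m * β ≤ Real.exp 1 ^ l := by
    have h1 : (m : ℝ) * m ≤ (n : ℝ) ^ l := by
      calc (m : ℝ) * m ≤ n * n := by gcongr
        _ = (n : ℝ) ^ 2 := (sq _).symm
        _ ≤ (n : ℝ) ^ l := pow_le_pow_right₀ (by exact_mod_cast (by omega : 1 ≤ n)) hl
    rw [hβ, div_pow, ← mul_assoc, mul_div_assoc', div_le_iff₀ (by positivity), mul_comm]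
    gcongr
  have hrun : m * (2 * α * β * (1 + 2 * α * β) ^ m) ≤ ε / 2 := by
    have h1 : (1 + 2 * α * β) ^ m ≤ Real.exp (2 * (α * (m * β))) := by
      calc (1 + 2 * α * β) ^ m ≤ Real.exp (2 * α * β) ^ m := by
            gcongr
            linarith [Real.add_one_le_exp (2 * α * β)]
        _ = _ := by rw [← Real.exp_nat_mul]; ring_nf
    calc m * (2 * α * β * (1 + 2 * α * β) ^ m)
        = 2 * (α * (m * β)) * (1 + 2 * α * β) ^ m := by ring
      _ ≤ 2 * (α * (m * β)) * Real.exp (2 * (α * (m * β))) := by gcongr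
      _ ≤ 2 * (α * Real.exp 1 ^ l) * Real.exp (2 * (α * Real.exp 1 ^ l)) := by gcongr
      _ ≤ ε / 2 := hαε
  have hend := hm₀ m (by omega)
  have := two_sub_le_rainbowHamCycleProb (by omega : k ≤ n) (by rw [hkld, hdiv]) hm0 hqc hp0 hp1
    hsum
  linarith
end
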